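/- Assume the solution is nontrivial (S is not a horizontal line) and u² + v² ≠ 0 at every point of the closure of Ω. Then near any crest the free surface S is locally the graph of a C² function y = η(x), and η″ < 0 at the crest (S is strictly concave there); similarly, near any trough S is locally the graph of a C² function y = η(x), and η″ > 0 at the trough (S is strictly convex there). -/

import Mathlib

open Set

/-- Partial derivative in the horizontal direction. -/
noncomputable def pdX (f : ℝ × ℝ → ℝ) (p : ℝ × ℝ) : ℝ := fderiv ℝ f p (1, 0)

/-- Partial derivative in the vertical direction. -/
noncomputable def pdY (f : ℝ × ℝ → ℝ) (p : ℝ × ℝ) : ℝ := fderiv ℝ f p (0, 1)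

/-- A general (possibly overturning, possibly asymmetric) horizontally `2L`-periodic
steady water wave.  The free surface `S` is the non-self-intersecting `C²` curve
parametrized by `s ↦ (X s, Y s)`, lying above the bed `B = {y = -d}`, and the fluid
domain `Ω` is the open connected `2L`-periodic region whose boundary is `S ∪ B`.
The flow `(u, v)` with pressure `P` solves the steady Euler equations in `Ω`, is
tangent to `S`, has `P = Patm` on `S` and `v = 0` on `B`; `ψ` is a stream function,
vanishing on `S` and equal to the constant `m` on `B`. -/
structure GenPeriodicFlow (g Patm L d : ℝ) : Type where
  X : ℝ → ℝ
  Y : ℝ → ℝ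
  T : ℝ
  u : ℝ × ℝ → ℝ
  v : ℝ × ℝ → ℝ
  P : ℝ × ℝ → ℝ
  ψ : ℝ × ℝ → ℝ
  m : ℝ
  Ω : Set (ℝ × ℝ)
  T_pos : 0 < T
  X_smooth : ContDiff ℝ 2 X
  Y_smooth : ContDiff ℝ 2 Y
  regular : ∀ s, deriv X s ^ 2 + deriv Y s ^ 2 ≠ 0
  X_per : ∀ s, X (s + T) = X s + 2 * L
  Y_per : ∀ s, Y (s + T) = Y s
  S_above_bed : ∀ s, -d < Y s
  S_simple : ∀ s s', X s = X s' → Y s = Y s' → ∃ n : ℤ, s' = s + n * T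
  Ω_open : IsOpen Ω
  Ω_conn : IsConnected Ω
  Ω_per : ∀ p : ℝ × ℝ, p ∈ Ω ↔ (p.1 + 2 * L, p.2) ∈ Ω
  Ω_frontier : frontier Ω = (range fun s => (X s, Y s)) ∪ {p : ℝ × ℝ | p.2 = -d}
  u_smooth : ContDiff ℝ 1 u
  v_smooth : ContDiff ℝ 1 v
  P_smooth : ContDiff ℝ 2 P
  ψ_smooth : ContDiff ℝ 2 ψ
  u_periodic : ∀ x y, u (x + 2 * L, y) = u (x, y)
  v_periodic : ∀ x y, v (x + 2 * L, y) = v (x, y)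
  P_periodic : ∀ x y, P (x + 2 * L, y) = P (x, y)
  euler_x : ∀ p ∈ Ω, u p * pdX u p + v p * pdY u p = -pdX P p
  euler_y : ∀ p ∈ Ω, u p * pdX v p + v p * pdY v p = -(pdY P p) - g
  incompressible : ∀ p ∈ Ω, pdX u p + pdY v p = 0
  surface_pressure : ∀ s, P (X s, Y s) = Patm
  surface_tangency : ∀ s, u (X s, Y s) * deriv Y s = v (X s, Y s) * deriv X s
  bed_kinematic : ∀ x, v (x, -d) = 0
  psi_x : ∀ p ∈ closure Ω, pdX ψ p = -v p
  psi_y : ∀ p ∈ closure Ω, pdY ψ p = u p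
  psi_surface : ∀ s, ψ (X s, Y s) = 0
  psi_bed : ∀ x, ψ (x, -d) = m

namespace GenPeriodicFlow

variable {g Patm L d : ℝ}

/-- The vorticity `ω = v_x - u_y`. -/
noncomputable def vort (F : GenPeriodicFlow g Patm L d) (p : ℝ × ℝ) : ℝ :=
  pdX F.v p - pdY F.u p

/-- The free surface `S`, as a subset of the plane. -/
def surf (F : GenPeriodicFlow g Patm L d) : Set (ℝ × ℝ) :=
  range fun s => (F.X s, F.Y s)

/-- The maximal surface height `maxη = max_S y`. -/
noncomputable def maxη (F : GenPeriodicFlow g Patm L d) : ℝ := sSup (range F.Y)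

/-- The minimal surface height `minη = min_S y`. -/
noncomputable def minη (F : GenPeriodicFlow g Patm L d) : ℝ := sInf (range F.Y)

/-- The solution is nontrivial: `S` is not a horizontal line. -/
def Nontrivial' (F : GenPeriodicFlow g Patm L d) : Prop := ∃ s s', F.Y s ≠ F.Y s'

/-- `n` is an outward (non-fluid side) normal to `S` at the parameter `s`:
it is orthogonal to the tangent vector and points out of the fluid. -/
def IsOutwardNormalAt (F : GenPeriodicFlow g Patm L d) (n : ℝ × ℝ) (s : ℝ) : Prop :=
  n.1 * deriv F.X s + n.2 * deriv F.Y s = 0 ∧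
  ∃ t₀ > 0, ∀ t, 0 < t → t < t₀ → (F.X s + t * n.1, F.Y s + t * n.2) ∉ closure F.Ω

end GenPeriodicFlow

/-- A crossing property of the plane: a continuous map of the square into `ℂ` whose real part
changes sign between two opposite sides and whose imaginary part changes sign between the other two
sides vanishes somewhere. -/
lemma exists_eq_zero_of_opposite_sides {H : ℝ × ℝ → ℂ} (hH : Continuous H)
    (hr : ∀ t ∈ Icc (0 : ℝ) 1, 0 < (H (t, 1)).re) (hl : ∀ t ∈ Icc (0 : ℝ) 1, (H (t, 0)).re < 0)
    (hb : ∀ s ∈ Icc (0 : ℝ) 1, (H (0, s)).im < 0) (ht : ∀ s ∈ Icc (0 : ℝ) 1, 0 < (H (1, s)).im) :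
    ∃ z, H z = 0 := by
  by_contra! hne
  obtain ⟨φ, ⟨hφ0, hφ⟩, -⟩ := Complex.isCoveringMapOn_exp.existsUnique_continuousMap_lifts
    ⟨H, hH⟩ (a₀ := (0, 1)) (e₀ := Complex.log (H (0, 1))) (Complex.exp_log (hne _))
    (fun a => by simpa using hne a)
  obtain ⟨a, ha⟩ : ∃ a : ℝ × ℝ → ℝ, ∀ z, a z = (φ z).im := ⟨_, fun _ => rfl⟩
  have hac : Continuous a := by
    rw [funext ha]; exact Complex.continuous_im.comp φ.continuous
  have hexp : ∀ z, Complex.exp (φ z) = H z := fun z => congrFun hφ z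
  have hre : ∀ z, (H z).re = Real.exp (φ z).re * Real.cos (a z) := fun z => by
    rw [← hexp, Complex.exp_re, ha]
  have him : ∀ z, (H z).im = Real.exp (φ z).re * Real.sin (a z) := fun z => by
    rw [← hexp, Complex.exp_im, ha]
  have hcos_r : ∀ t ∈ Icc (0 : ℝ) 1, 0 < Real.cos (a (t, 1)) := fun t h => by
    have := hr t h; rw [hre] at this
    exact pos_of_mul_pos_right this (Real.exp_pos _).le
  have hcos_l : ∀ t ∈ Icc (0 : ℝ) 1, Real.cos (a (t, 0)) < 0 := fun t h => by
    have := hl t h; rw [hre] at this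
    exact neg_of_mul_neg_right this (Real.exp_pos _).le
  have hsin_b : ∀ t ∈ Icc (0 : ℝ) 1, Real.sin (a (0, t)) < 0 := fun t h => by
    have := hb t h; rw [him] at this
    exact neg_of_mul_neg_right this (Real.exp_pos _).le
  have hsin_t : ∀ t ∈ Icc (0 : ℝ) 1, 0 < Real.sin (a (1, t)) := fun t h => by
    have := ht t h; rw [him] at this
    exact pos_of_mul_pos_right this (Real.exp_pos _).le
  have i0 : (0 : ℝ) ∈ Icc (0 : ℝ) 1 := by simp
  have i1 : (1 : ℝ) ∈ Icc (0 : ℝ) 1 := by simp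
  have ivt : ∀ {f : ℝ → ℝ}, Continuous f → ∀ c : ℝ, (∀ t ∈ Icc (0 : ℝ) 1, f t ≠ c) →
      ∀ x ∈ Icc (0 : ℝ) 1, ∀ y ∈ Icc (0 : ℝ) 1, f x < c → f y < c := by
    intro f hf c hc x hx y hy hxc
    by_contra! hy'
    obtain ⟨z, hz, hzc⟩ := isPreconnected_Icc.intermediate_value hx hy hf.continuousOn
      ⟨hxc.le, hy'⟩
    exact hc z hz hzc
  have ivt' : ∀ {f : ℝ → ℝ}, Continuous f → ∀ c : ℝ, (∀ t ∈ Icc (0 : ℝ) 1, f t ≠ c) →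
      ∀ x ∈ Icc (0 : ℝ) 1, ∀ y ∈ Icc (0 : ℝ) 1, c < f x → c < f y := by
    intro f hf c hc x hx y hy hxc
    have := ivt hf.neg (-c) (fun t ht h => hc t ht (by simpa using h)) x hx y hy
      (by simpa using hxc)
    simpa using this
  have hpi := Real.pi_pos
  have hq : -(Real.pi / 2) < a (0, 1) ∧ a (0, 1) < Real.pi / 2 := by
    rw [← abs_lt]
    have : a (0, 1) = (H (0, 1)).arg := by simp [ha, hφ0, Complex.log_im]
    rw [this, Complex.abs_arg_lt_pi_div_two_iff]
    exact Or.inl (hr 0 i0)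
  have c01 : a (0, 1) < 0 := by
    by_contra! h
    exact absurd (hsin_b 1 i1) (not_lt.2 (Real.sin_nonneg_of_nonneg_of_le_pi h (by linarith)))
  have bot : ∀ s ∈ Icc (0 : ℝ) 1, a (0, s) < 0 := fun s hs =>
    ivt (f := fun s => a (0, s)) (by fun_prop) 0
      (fun t ht h => by have := hsin_b t ht; rw [h, Real.sin_zero] at this; exact lt_irrefl _ this)
      1 i1 s hs c01
  have r1 : -(Real.pi / 2) < a (1, 1) :=
    ivt' (f := fun t => a (t, 1)) (by fun_prop) (-(Real.pi / 2))
      (fun t ht h => by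
        have := hcos_r t ht; rw [h, Real.cos_neg, Real.cos_pi_div_two] at this
        exact lt_irrefl _ this)
      0 i0 1 i1 hq.1
  have r2 : a (1, 1) < Real.pi / 2 := ivt (f := fun t => a (t, 1)) (by fun_prop) (Real.pi / 2)
      (fun t ht h => by
        have := hcos_r t ht; rw [h, Real.cos_pi_div_two] at this
        exact lt_irrefl _ this)
      0 i0 1 i1 hq.2
  have c11 : 0 < a (1, 1) := by
    by_contra! h
    exact absurd (hsin_t 1 i1) (not_lt.2 (Real.sin_nonpos_of_nonpos_of_neg_pi_le h (by linarith)))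
  have top : 0 < a (1, 0) := ivt' (f := fun s => a (1, s)) (by fun_prop) 0
      (fun t ht h => by have := hsin_t t ht; rw [h, Real.sin_zero] at this; exact lt_irrefl _ this)
      1 i1 0 i0 c11
  have := ivt (f := fun t => a (t, 0)) (by fun_prop) 0
      (fun t ht h => by have := hcos_l t ht; rw [h, Real.cos_zero] at this; linarith)
      0 i0 1 i1 (bot 0 i0)
  linarith

lemma hasDerivAt_pdX {f : ℝ × ℝ → ℝ} {p : ℝ × ℝ} (hf : DifferentiableAt ℝ f p) :
    HasDerivAt (fun t => f (t, p.2)) (pdX f p) p.1 := by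
  have h1 : HasDerivAt (fun t : ℝ => (t, p.2)) ((1 : ℝ), (0 : ℝ)) p.1 :=
    (hasDerivAt_id p.1).prodMk (hasDerivAt_const _ _)
  exact (show HasFDerivAt f (fderiv ℝ f p) (p.1, p.2) from hf.hasFDerivAt).comp_hasDerivAt p.1 h1

lemma hasDerivAt_pdY {f : ℝ × ℝ → ℝ} {p : ℝ × ℝ} (hf : DifferentiableAt ℝ f p) :
    HasDerivAt (fun t => f (p.1, t)) (pdY f p) p.2 := by
  have h1 : HasDerivAt (fun t : ℝ => (p.1, t)) ((0 : ℝ), (1 : ℝ)) p.2 :=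
    (hasDerivAt_const _ _).prodMk (hasDerivAt_id p.2)
  exact (show HasFDerivAt f (fderiv ℝ f p) (p.1, p.2) from hf.hasFDerivAt).comp_hasDerivAt p.2 h1

lemma fderiv_eq_pd (f : ℝ × ℝ → ℝ) (p w : ℝ × ℝ) :
    fderiv ℝ f p w = w.1 * pdX f p + w.2 * pdY f p := by
  have : w = w.1 • ((1 : ℝ), (0 : ℝ)) + w.2 • ((0 : ℝ), (1 : ℝ)) := by
    ext <;> simp
  conv_lhs => rw [this]
  rw [map_add, map_smul, map_smul]; rfl

lemma contDiff_pdX {f : ℝ × ℝ → ℝ} (hf : ContDiff ℝ 2 f) : ContDiff ℝ 1 (pdX f) :=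
  (hf.fderiv_right (m := 1) (by norm_num)).clm_apply contDiff_const

lemma contDiff_pdY {f : ℝ × ℝ → ℝ} (hf : ContDiff ℝ 2 f) : ContDiff ℝ 1 (pdY f) :=
  (hf.fderiv_right (m := 1) (by norm_num)).clm_apply contDiff_const

lemma continuous_pdX {f : ℝ × ℝ → ℝ} (hf : ContDiff ℝ 1 f) : Continuous (pdX f) :=
  (hf.continuous_fderiv one_ne_zero).clm_apply continuous_const

lemma continuous_pdY {f : ℝ × ℝ → ℝ} (hf : ContDiff ℝ 1 f) : Continuous (pdY f) :=
  (hf.continuous_fderiv one_ne_zero).clm_apply continuous_const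

lemma pdX_neg (f : ℝ × ℝ → ℝ) (p : ℝ × ℝ) : pdX (fun z => -f z) p = -pdX f p := by
  simp [pdX]

lemma pdY_neg (f : ℝ × ℝ → ℝ) (p : ℝ × ℝ) : pdY (fun z => -f z) p = -pdY f p := by
  simp [pdY]

/-- The second derivative is nonpositive at a local maximum. -/
lemma second_deriv_nonpos_of_isLocalMax {φ φ' : ℝ → ℝ} {x c : ℝ} (h : IsLocalMax φ x)
    (h1 : ∀ t, HasDerivAt φ (φ' t) t) (h2 : HasDerivAt φ' c x) : c ≤ 0 := by
  by_contra! hc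
  have e1 : deriv φ = φ' := funext fun t => (h1 t).deriv
  have hmin : IsLocalMin φ x := by
    refine isLocalMin_of_deriv_deriv_pos (by rw [e1, h2.deriv]; exact hc) ?_ (h1 x).continuousAt
    exact h.deriv_eq_zero
  have hev : φ =ᶠ[nhds x] fun _ => φ x := by
    filter_upwards [h, hmin] with t ht ht'
    exact le_antisymm ht ht'
  have e2 := hev.deriv.deriv_eq
  rw [e1, h2.deriv] at e2
  simp at e2
  exact hc.ne' e2

lemma laplacian_nonpos_of_isLocalMax {f : ℝ × ℝ → ℝ} {p : ℝ × ℝ} (hf : ContDiff ℝ 2 f)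
    (h : IsLocalMax f p) : pdX (pdX f) p + pdY (pdY f) p ≤ 0 := by
  have hd : ∀ q, DifferentiableAt ℝ f q := fun q => hf.contDiffAt.differentiableAt (by norm_num)
  have hx : IsLocalMax (fun t => f (t, p.2)) p.1 :=
    IsMaxFilter.comp_tendsto (f := f) (l := nhds p) h
      ((by fun_prop : Continuous fun t : ℝ => (t, p.2)).tendsto p.1)
  have hy : IsLocalMax (fun t => f (p.1, t)) p.2 :=
    IsMaxFilter.comp_tendsto (f := f) (l := nhds p) h
      ((by fun_prop : Continuous fun t : ℝ => (p.1, t)).tendsto p.2)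
  have h1 := second_deriv_nonpos_of_isLocalMax hx (fun t => hasDerivAt_pdX (hd (t, p.2)))
    (hasDerivAt_pdX ((contDiff_pdX hf).contDiffAt.differentiableAt (by norm_num)))
  have h2 := second_deriv_nonpos_of_isLocalMax hy (fun t => hasDerivAt_pdY (hd (p.1, t)))
    (hasDerivAt_pdY ((contDiff_pdY hf).contDiffAt.differentiableAt (by norm_num)))
  linarith

lemma deriv_nonpos_of_le_right {φ : ℝ → ℝ} {x c δ : ℝ} (h : HasDerivAt φ c x) (hδ : 0 < δ)
    (hle : ∀ t ∈ Ioo x (x + δ), φ t ≤ φ x) : c ≤ 0 := by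
  have h1 := (hasDerivWithinAt_iff_tendsto_slope' (by simp)).1 (h.hasDerivWithinAt (s := Ioi x))
  refine le_of_tendsto h1 ?_
  filter_upwards [Ioo_mem_nhdsGT (show x < x + δ by linarith)] with t ht
  rw [slope_def_field]
  exact div_nonpos_of_nonpos_of_nonneg (by linarith [hle t ht]) (by linarith [ht.1])

/-- Squared Euclidean distance in the plane. -/
def sqDist (p z : ℝ × ℝ) : ℝ := (p.1 - z.1) ^ 2 + (p.2 - z.2) ^ 2

lemma contDiff_sqDist (z : ℝ × ℝ) : ContDiff ℝ 2 fun p => sqDist p z := by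
  unfold sqDist; fun_prop

lemma isCompact_sqDist_le (z : ℝ × ℝ) (r : ℝ) : IsCompact {p | sqDist p z ≤ r} := by
  refine Metric.isCompact_of_isClosed_isBounded
    (isClosed_le (contDiff_sqDist z).continuous continuous_const) ?_
  refine Metric.isBounded_closedBall (x := z) (r := r + 1) |>.subset fun p hp => ?_
  have hp' : (p.1 - z.1) ^ 2 + (p.2 - z.2) ^ 2 ≤ r := hp
  rw [Metric.mem_closedBall, Prod.dist_eq, Real.dist_eq, Real.dist_eq]
  refine max_le (abs_le.2 ⟨?_, ?_⟩) (abs_le.2 ⟨?_, ?_⟩) <;> nlinarith [sq_nonneg (p.1 - z.1 - 1),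
    sq_nonneg (p.1 - z.1 + 1), sq_nonneg (p.2 - z.2 - 1), sq_nonneg (p.2 - z.2 + 1)]

/-- The radial barrier function used in Hopf's lemma. -/
noncomputable def barrier (α : ℝ) (z p : ℝ × ℝ) : ℝ := Real.exp (-α * sqDist p z)

lemma contDiff_barrier (α : ℝ) (z : ℝ × ℝ) : ContDiff ℝ 2 (barrier α z) :=
  Real.contDiff_exp.comp (contDiff_const.mul (contDiff_sqDist z))

lemma pdX_barrier (α : ℝ) (z p : ℝ × ℝ) :
    pdX (barrier α z) p = -2 * α * (p.1 - z.1) * barrier α z p := by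
  refine (hasDerivAt_pdX ((contDiff_barrier α z).contDiffAt.differentiableAt
    (by norm_num))).unique ?_
  have h := (((((hasDerivAt_id p.1).sub_const z.1).pow 2).add_const
    ((p.2 - z.2) ^ 2)).const_mul (-α)).exp
  refine h.congr_deriv ?_
  simp [barrier, sqDist]; ring

lemma pdY_barrier (α : ℝ) (z p : ℝ × ℝ) :
    pdY (barrier α z) p = -2 * α * (p.2 - z.2) * barrier α z p := by
  refine (hasDerivAt_pdY ((contDiff_barrier α z).contDiffAt.differentiableAt
    (by norm_num))).unique ?_
  have h := (((((hasDerivAt_id p.2).sub_const z.2).pow 2).const_add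
    ((p.1 - z.1) ^ 2)).const_mul (-α)).exp
  refine h.congr_deriv ?_
  simp [barrier, sqDist]; ring

lemma pdX_pdX_barrier (α : ℝ) (z p : ℝ × ℝ) : pdX (pdX (barrier α z)) p =
    (4 * α ^ 2 * (p.1 - z.1) ^ 2 - 2 * α) * barrier α z p := by
  have hd := (contDiff_barrier α z).contDiffAt (x := p) |>.differentiableAt (by norm_num)
  refine (hasDerivAt_pdX ((contDiff_pdX (contDiff_barrier α z)).contDiffAt.differentiableAt
    (by norm_num))).unique ?_
  simp_rw [pdX_barrier]
  refine ((((hasDerivAt_id p.1).sub_const z.1).const_mul (-2 * α)).mul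
    (hasDerivAt_pdX hd)).congr_deriv ?_
  simp [pdX_barrier]; ring

lemma pdY_pdY_barrier (α : ℝ) (z p : ℝ × ℝ) : pdY (pdY (barrier α z)) p =
    (4 * α ^ 2 * (p.2 - z.2) ^ 2 - 2 * α) * barrier α z p := by
  have hd := (contDiff_barrier α z).contDiffAt (x := p) |>.differentiableAt (by norm_num)
  refine (hasDerivAt_pdY ((contDiff_pdY (contDiff_barrier α z)).contDiffAt.differentiableAt
    (by norm_num))).unique ?_
  simp_rw [pdY_barrier]
  refine ((((hasDerivAt_id p.2).sub_const z.2).const_mul (-2 * α)).mul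
    (hasDerivAt_pdY hd)).congr_deriv ?_
  simp [pdY_barrier]; ring

lemma pdX_add_mul {f w : ℝ × ℝ → ℝ} {p : ℝ × ℝ} (hf : DifferentiableAt ℝ f p)
    (hw : DifferentiableAt ℝ w p) (c k : ℝ) :
    pdX (fun q => f q + c * (w q - k)) p = pdX f p + c * pdX w p :=
  (hasDerivAt_pdX (hf.add ((hw.sub_const k).const_mul c))).unique
    ((hasDerivAt_pdX hf).add (((hasDerivAt_pdX hw).sub_const k).const_mul c))

lemma pdY_add_mul {f w : ℝ × ℝ → ℝ} {p : ℝ × ℝ} (hf : DifferentiableAt ℝ f p)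
    (hw : DifferentiableAt ℝ w p) (c k : ℝ) :
    pdY (fun q => f q + c * (w q - k)) p = pdY f p + c * pdY w p :=
  (hasDerivAt_pdY (hf.add ((hw.sub_const k).const_mul c))).unique
    ((hasDerivAt_pdY hf).add (((hasDerivAt_pdY hw).sub_const k).const_mul c))

/-- **Hopf's boundary point lemma** on a disc, for functions satisfying the differential inequality
`|Δf| ≤ K |∇f|`. -/
lemma hopf_boundary_point {f : ℝ × ℝ → ℝ} (hf : ContDiff ℝ 2 f) {z c : ℝ × ℝ} {R K M : ℝ}
    (hR : 0 < R) (hK : 0 ≤ K)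
    (hlap : ∀ p, sqDist p z < R ^ 2 →
      |pdX (pdX f) p + pdY (pdY f) p| ≤ K * (|pdX f p| + |pdY f p|))
    (hlt : ∀ p, sqDist p z < R ^ 2 → f p < M) (hle : ∀ p, sqDist p z = R ^ 2 → f p ≤ M)
    (hc : sqDist c z = R ^ 2) (hfc : f c = M) :
    fderiv ℝ f c (z - c) < 0 := by
  have hdf : Differentiable ℝ f := hf.differentiable (by norm_num)
  obtain ⟨α, hα⟩ : ∃ α, α = (5 + 4 * K * R) / R ^ 2 := ⟨_, rfl⟩
  have hαR : α * R ^ 2 = 5 + 4 * K * R := by rw [hα]; field_simp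
  have hα0 : 0 < α := by rw [hα]; positivity
  have hdw : Differentiable ℝ (barrier α z) := (contDiff_barrier α z).differentiable (by norm_num)
  obtain ⟨m₀, hm₀, hm₀max⟩ := (isCompact_sqDist_le z (R ^ 2 / 4)).exists_isMaxOn
    ⟨z, by simp only [mem_ofPred_eq, sqDist]; nlinarith⟩ hf.continuous.continuousOn
  have hm₀' : sqDist m₀ z ≤ R ^ 2 / 4 := hm₀
  obtain ⟨ε, hε⟩ : ∃ ε, ε = M - f m₀ := ⟨_, rfl⟩
  have hε0 : 0 < ε := by
    have := hlt m₀ (by nlinarith)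
    linarith
  obtain ⟨k, hk⟩ : ∃ k, k = Real.exp (-α * R ^ 2) := ⟨_, rfl⟩
  have hk0 : 0 < k := hk ▸ Real.exp_pos _
  have hkey : ∀ p, sqDist p z ≤ R ^ 2 → f p + ε * (barrier α z p - k) ≤ M := by
    have hhC : ContDiff ℝ 2 fun p => f p + ε * (barrier α z p - k) :=
      hf.add (contDiff_const.mul ((contDiff_barrier α z).sub contDiff_const))
    obtain ⟨m, hm, hmax⟩ := (isCompact_sqDist_le z (R ^ 2)).exists_isMaxOn
      ⟨c, hc.le⟩ hhC.continuous.continuousOn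
    have hm' : sqDist m z ≤ R ^ 2 := hm
    suffices hmM : f m + ε * (barrier α z m - k) ≤ M from fun p hp => (hmax hp).trans hmM
    rcases hm'.eq_or_lt with h1 | h1
    · have : barrier α z m = k := by rw [barrier, h1, hk]
      rw [this]; linarith [hle m h1]
    rcases le_or_gt (sqDist m z) (R ^ 2 / 4) with h2 | h2
    · have hb : barrier α z m ≤ 1 := by
        refine Real.exp_le_one_iff.2 ?_
        have : 0 ≤ sqDist m z := by unfold sqDist; positivity
        nlinarith
      have : f m ≤ f m₀ := hm₀max h2
      nlinarith
    exfalso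
    have hloc : IsLocalMax (fun p => f p + ε * (barrier α z p - k)) m := by
      have hopen : IsOpen {p | sqDist p z < R ^ 2} :=
        isOpen_lt (contDiff_sqDist z).continuous continuous_const
      filter_upwards [hopen.mem_nhds h1] with p hp
      exact hmax (le_of_lt hp)
    have hlapm := laplacian_nonpos_of_isLocalMax hhC hloc
    have hz := hloc.fderiv_eq_zero
    have gx : pdX f m + ε * pdX (barrier α z) m = 0 := by
      rw [← pdX_add_mul (hdf m) (hdw m) ε k, pdX, hz]; rfl
    have gy : pdY f m + ε * pdY (barrier α z) m = 0 := by
      rw [← pdY_add_mul (hdf m) (hdw m) ε k, pdY, hz]; rfl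
    have ex : pdX (fun p => f p + ε * (barrier α z p - k)) =
        fun p => pdX f p + ε * (pdX (barrier α z) p - 0) := by
      funext p; rw [pdX_add_mul (hdf p) (hdw p), sub_zero]
    have ey : pdY (fun p => f p + ε * (barrier α z p - k)) =
        fun p => pdY f p + ε * (pdY (barrier α z) p - 0) := by
      funext p; rw [pdY_add_mul (hdf p) (hdw p), sub_zero]
    rw [ex, ey, pdX_add_mul ((contDiff_pdX hf).differentiable (by norm_num) m)
      ((contDiff_pdX (contDiff_barrier α z)).differentiable (by norm_num) m),
      pdY_add_mul ((contDiff_pdY hf).differentiable (by norm_num) m)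
      ((contDiff_pdY (contDiff_barrier α z)).differentiable (by norm_num) m),
      pdX_pdX_barrier, pdY_pdY_barrier] at hlapm
    rw [pdX_barrier] at gx
    rw [pdY_barrier] at gy
    have hw0 : 0 < barrier α z m := Real.exp_pos _
    obtain ⟨w, hw⟩ : ∃ w, w = barrier α z m := ⟨_, rfl⟩
    rw [← hw] at gx gy hlapm hw0
    have ax : |m.1 - z.1| ≤ R := abs_le_of_sq_le_sq (by
      have : (m.1 - z.1) ^ 2 + (m.2 - z.2) ^ 2 ≤ R ^ 2 := hm
      nlinarith [sq_nonneg (m.2 - z.2)]) hR.le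
    have ay : |m.2 - z.2| ≤ R := abs_le_of_sq_le_sq (by
      have : (m.1 - z.1) ^ 2 + (m.2 - z.2) ^ 2 ≤ R ^ 2 := hm
      nlinarith [sq_nonneg (m.1 - z.1)]) hR.le
    have bx : |pdX f m| ≤ ε * w * α * 2 * R := by
      rw [show pdX f m = (ε * w * α * 2) * (m.1 - z.1) by linarith, abs_mul,
        abs_of_pos (by positivity)]
      gcongr
    have bY : |pdY f m| ≤ ε * w * α * 2 * R := by
      rw [show pdY f m = (ε * w * α * 2) * (m.2 - z.2) by linarith, abs_mul,
        abs_of_pos (by positivity)]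
      gcongr
    have hL := (abs_le.1 (hlap m h1)).1
    have hKb : K * (|pdX f m| + |pdY f m|) ≤ K * (ε * w * α * 2 * R + ε * w * α * 2 * R) := by
      gcongr
    have hr : 4 * α * sqDist m z > α * R ^ 2 := by nlinarith
    have hpos : 0 < ε * w * α := by positivity
    have hfin : 0 < ε * w * α * (4 * α * sqDist m z - 4 - 4 * K * R) :=
      mul_pos hpos (by linarith)
    have hexp : ε * w * α * (4 * α * sqDist m z - 4 - 4 * K * R) =
      ε * ((4 * α ^ 2 * (m.1 - z.1) ^ 2 - 2 * α) * w) +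
      ε * ((4 * α ^ 2 * (m.2 - z.2) ^ 2 - 2 * α) * w) -
        K * (ε * w * α * 2 * R + ε * w * α * 2 * R) := by unfold sqDist; ring
    linarith
  have hline : HasDerivAt (fun t : ℝ => c + t • (z - c)) (z - c) 0 := by
    simpa using ((hasDerivAt_id (0 : ℝ)).smul_const (z - c)).const_add c
  have h1 : HasDerivAt (fun t : ℝ => f (c + t • (z - c))) (fderiv ℝ f c (z - c)) 0 :=
    HasFDerivAt.comp_hasDerivAt (f := fun t : ℝ => c + t • (z - c)) (0 : ℝ)
      (by simpa using (hdf c).hasFDerivAt) hline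
  have h2 : HasDerivAt (fun t : ℝ => barrier α z (c + t • (z - c)))
      (fderiv ℝ (barrier α z) c (z - c)) 0 :=
    HasFDerivAt.comp_hasDerivAt (f := fun t : ℝ => c + t • (z - c)) (l := barrier α z) (0 : ℝ)
      (by simpa using (hdw c).hasFDerivAt) hline
  have hbc : barrier α z c = k := by rw [barrier, hc, hk]
  have h3 := deriv_nonpos_of_le_right (h1.add ((h2.sub_const k).const_mul ε)) (δ := 1) one_pos (by
    intro t ht
    simp only [Pi.add_apply, zero_smul, add_zero, hbc, hfc, sub_self, mul_zero]
    apply hkey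
    have : sqDist (c + t • (z - c)) z = (1 - t) ^ 2 * sqDist c z := by
      simp [sqDist]; ring
    rw [this, hc]
    have := ht.1; have := ht.2
    have : (1 - t) ^ 2 ≤ 1 := by nlinarith
    nlinarith [sq_nonneg R])
  rw [fderiv_eq_pd (barrier α z), pdX_barrier, pdY_barrier, hbc] at h3
  have h4 : (z - c).1 * (-2 * α * (c.1 - z.1) * k) + (z - c).2 * (-2 * α * (c.2 - z.2) * k) =
      2 * α * k * R ^ 2 := by
    rw [← hc]; simp [sqDist]; ring
  rw [h4] at h3
  have : 0 < ε * (2 * α * k * R ^ 2) := by positivity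
  linarith

/-- **Strong maximum principle** for functions satisfying `|Δf| ≤ k |∇f|` with `k` continuous. -/
lemma strong_maximum_principle {f k : ℝ × ℝ → ℝ} (hf : ContDiff ℝ 2 f) {U : Set (ℝ × ℝ)}
    (hU : IsOpen U) (hUc : IsPreconnected U) (hk : ContinuousOn k U)
    (hlap : ∀ p ∈ U, |pdX (pdX f) p + pdY (pdY f) p| ≤ k p * (|pdX f p| + |pdY f p|))
    {M : ℝ} (hM : ∀ p ∈ U, f p ≤ M) {p₀ : ℝ × ℝ} (hp₀ : p₀ ∈ U) (hfp₀ : f p₀ = M) :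
    ∀ p ∈ U, f p = M := by
  have hV : IsOpen (U ∩ f ⁻¹' {M}ᶜ) := hU.inter (isOpen_compl_singleton.preimage hf.continuous)
  have hW : IsOpen {p ∈ U | f p = M} := by
    rw [Metric.isOpen_iff]
    rintro a ⟨haU, haM⟩
    obtain ⟨r, hr, hball⟩ := Metric.isOpen_iff.1 hU a haU
    refine ⟨r / 4, by positivity, fun z hz => ?_⟩
    have hzr : |z.1 - a.1| < r / 4 ∧ |z.2 - a.2| < r / 4 := by
      rw [Metric.mem_ball, Prod.dist_eq, Real.dist_eq, Real.dist_eq] at hz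
      exact max_lt_iff.1 hz
    obtain ⟨⟨z1, z1'⟩, ⟨z2, z2'⟩⟩ := And.intro (abs_lt.1 hzr.1) (abs_lt.1 hzr.2)
    have hza : sqDist a z ≤ r ^ 2 / 8 := by
      have e1 : (a.1 - z.1) ^ 2 ≤ (r / 4) ^ 2 := sq_le_sq' (by linarith) (by linarith)
      have e2 : (a.2 - z.2) ^ 2 ≤ (r / 4) ^ 2 := sq_le_sq' (by linarith) (by linarith)
      unfold sqDist; nlinarith
    have hsub : {p | sqDist p z ≤ sqDist a z} ⊆ U := by
      intro p hp
      have hp' : (p.1 - z.1) ^ 2 + (p.2 - z.2) ^ 2 ≤ r ^ 2 / 8 := le_trans hp hza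
      have b1 : |p.1 - z.1| ≤ r / 2 := abs_le_of_sq_le_sq (by
        nlinarith [sq_nonneg (p.2 - z.2)]) (by linarith)
      have b2 : |p.2 - z.2| ≤ r / 2 := abs_le_of_sq_le_sq (by
        nlinarith [sq_nonneg (p.1 - z.1)]) (by linarith)
      obtain ⟨⟨b1, b1'⟩, ⟨b2, b2'⟩⟩ := And.intro (abs_le.1 b1) (abs_le.1 b2)
      apply hball
      rw [Metric.mem_ball, Prod.dist_eq, Real.dist_eq, Real.dist_eq]
      exact max_lt (abs_lt.2 ⟨by linarith, by linarith⟩) (abs_lt.2 ⟨by linarith, by linarith⟩)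
    have hzU : z ∈ U := hsub (by
      have h0 : sqDist z z = 0 := by simp [sqDist]
      have : 0 ≤ sqDist a z := by unfold sqDist; positivity
      show sqDist z z ≤ sqDist a z
      linarith)
    refine ⟨hzU, ?_⟩
    by_contra hzM
    have hcomp : IsCompact ({p | sqDist p z ≤ sqDist a z} ∩ f ⁻¹' {M}) :=
      (isCompact_sqDist_le z _).inter_right (isClosed_singleton.preimage hf.continuous)
    obtain ⟨c, ⟨hca, hcM⟩, hcmin⟩ := hcomp.exists_isMinOn (f := fun p => sqDist p z)
      ⟨a, le_refl (sqDist a z), haM⟩ (contDiff_sqDist z).continuous.continuousOn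
    have hca' : sqDist c z ≤ sqDist a z := hca
    have hcM' : f c = M := hcM
    have hR0 : 0 < sqDist c z := by
      have h0 : 0 ≤ sqDist c z := by unfold sqDist; positivity
      rcases h0.eq_or_lt with h | h
      · exfalso
        have h' : (c.1 - z.1) ^ 2 + (c.2 - z.2) ^ 2 = 0 := h.symm
        have h1 : c.1 = z.1 := by nlinarith [sq_nonneg (c.1 - z.1), sq_nonneg (c.2 - z.2)]
        have h2 : c.2 = z.2 := by nlinarith [sq_nonneg (c.1 - z.1), sq_nonneg (c.2 - z.2)]
        exact hzM (Prod.ext h1 h2 ▸ hcM')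
      · exact h
    have hRsq : Real.sqrt (sqDist c z) ^ 2 = sqDist c z := Real.sq_sqrt hR0.le
    obtain ⟨K, hKb⟩ := ((isCompact_sqDist_le z (sqDist a z)).image_of_continuousOn
      (hk.mono hsub)).bddAbove
    have hKb' : ∀ p, sqDist p z ≤ sqDist a z → k p ≤ max K 0 := fun p hp =>
      (hKb ⟨p, hp, rfl⟩).trans (le_max_left _ _)
    have hcU : c ∈ U := hsub hca
    have key := hopf_boundary_point hf (z := z) (c := c) (R := Real.sqrt (sqDist c z)) (M := M)
      (Real.sqrt_pos.2 hR0) (le_max_right K 0)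
      (fun p hp => by
        rw [hRsq] at hp
        have hpa : sqDist p z ≤ sqDist a z := hp.le.trans hca'
        refine (hlap p (hsub hpa)).trans ?_
        gcongr
        exact hKb' p hpa)
      (fun p hp => by
        rw [hRsq] at hp
        have hpa : sqDist p z ≤ sqDist a z := hp.le.trans hca'
        refine lt_of_le_of_ne (hM p (hsub hpa)) fun h => ?_
        exact absurd (hcmin ⟨hpa, h⟩) (not_le.2 hp))
      (fun p hp => hM p (hsub (by rw [mem_ofPred_eq, hp, hRsq]; exact hca')))
      hRsq.symm hcM'
    have hloc : IsLocalMax f c := by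
      filter_upwards [hU.mem_nhds hcU] with p hp
      rw [hcM']; exact hM p hp
    rw [hloc.fderiv_eq_zero] at key
    simp at key
  intro p hp
  by_contra hpM
  obtain ⟨x, -, hx1, hx2⟩ := hUc _ _ hW hV (fun q hq => by
    by_cases h : f q = M
    · exact Or.inl ⟨hq, h⟩
    · exact Or.inr ⟨hq, h⟩) ⟨p₀, hp₀, hp₀, hfp₀⟩ ⟨p, hp, hp, hpM⟩
  exact hx2.2 hx1.2

/-- Partial difference quotients of a `C¹` function converge locally uniformly. -/
lemma tendsto_diffQuot {f : ℝ × ℝ → ℝ} (hf : ContDiff ℝ 1 f) (p w : ℝ × ℝ) :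
    Filter.Tendsto (fun a : ℝ × (ℝ × ℝ) => (f (a.2 + a.1 • w) - f a.2) / a.1)
      (nhdsWithin 0 (Ioi 0) ×ˢ nhds p) (nhds (fderiv ℝ f p w)) := by
  have hs : HasStrictFDerivAt f (fderiv ℝ f p) p :=
    hf.contDiffAt.hasStrictFDerivAt one_ne_zero
  have h1 : Filter.Tendsto (fun a : ℝ × (ℝ × ℝ) => (a.2 + a.1 • w, a.2))
      (nhdsWithin 0 (Ioi 0) ×ˢ nhds p) (nhds (p, p)) := by
    have : Filter.Tendsto (fun a : ℝ × (ℝ × ℝ) => (a.2 + a.1 • w, a.2))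
      (nhds ((0 : ℝ), p)) (nhds (p + (0 : ℝ) • w, p)) :=
      (by fun_prop : Continuous fun a : ℝ × (ℝ × ℝ) => (a.2 + a.1 • w, a.2)).tendsto (0, p)
    rw [zero_smul, add_zero, nhds_prod_eq] at this
    exact this.mono_left (Filter.prod_mono_left _ nhdsWithin_le_nhds)
  have h2 := hs.isLittleO.comp_tendsto h1
  have hpos : ∀ᶠ a : ℝ × (ℝ × ℝ) in nhdsWithin 0 (Ioi 0) ×ˢ nhds p, 0 < a.1 :=
    Filter.tendsto_fst.eventually self_mem_nhdsWithin
  rw [tendsto_iff_norm_sub_tendsto_zero]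
  have h3 : (fun a : ℝ × (ℝ × ℝ) => f (a.2 + a.1 • w) - f a.2 - a.1 * fderiv ℝ f p w)
      =o[nhdsWithin 0 (Ioi 0) ×ˢ nhds p] fun a => a.1 := by
    have h4 : (fun a : ℝ × (ℝ × ℝ) => a.1 • w) =O[nhdsWithin 0 (Ioi 0) ×ˢ nhds p] fun a => a.1 :=
      Asymptotics.IsBigO.of_bound ‖w‖ (Filter.Eventually.of_forall fun a => by
        rw [norm_smul, mul_comm])
    refine (h2.congr (fun a => ?_) (fun a => ?_)).trans_isBigO h4
    · simp
    · simp
  refine (Asymptotics.isLittleO_iff_tendsto' ?_ |>.1 h3).norm.congr' ?_ |>.trans (by simp)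
  · filter_upwards [hpos] with a ha h
    exact absurd h ha.ne'
  · filter_upwards [hpos] with a ha
    congr 1
    field_simp

/-- A `C¹` divergence-free steady Euler flow with `C²` pressure satisfies
`ΔP = -(u_x² + 2 u_y v_x + v_y²)`, although its velocity need not be twice differentiable. -/
lemma laplacian_pressure {u v P : ℝ × ℝ → ℝ} (hu : ContDiff ℝ 1 u) (hv : ContDiff ℝ 1 v)
    (hP : ContDiff ℝ 2 P) {g : ℝ} {U : Set (ℝ × ℝ)} (hU : IsOpen U)
    (hx : ∀ p ∈ U, u p * pdX u p + v p * pdY u p = -pdX P p)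
    (hy : ∀ p ∈ U, u p * pdX v p + v p * pdY v p = -(pdY P p) - g)
    (hdiv : ∀ p ∈ U, pdX u p + pdY v p = 0) {p₀ : ℝ × ℝ} (hp₀ : p₀ ∈ U) :
    pdX (pdX P) p₀ + pdY (pdY P) p₀ =
      -(pdX u p₀ ^ 2 + 2 * (pdY u p₀ * pdX v p₀) + pdY v p₀ ^ 2) := by
  by_contra hne
  have hdu : Differentiable ℝ u := hu.differentiable one_ne_zero
  have hdv : Differentiable ℝ v := hv.differentiable one_ne_zero
  -- difference quotient of the divergence and its derivative along the flow
  obtain ⟨G, hG⟩ : ∃ G : ℝ → ℝ × ℝ → ℝ, ∀ h p, G h p =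
      (u (p + h • ((1 : ℝ), (0 : ℝ))) - u p) / h + (v (p + h • ((0 : ℝ), (1 : ℝ))) - v p) / h :=
    ⟨_, fun _ _ => rfl⟩
  obtain ⟨E, hE⟩ : ∃ E : ℝ × (ℝ × ℝ) → ℝ, ∀ a, E a =
      -((pdX P (a.2 + a.1 • ((1 : ℝ), (0 : ℝ))) - pdX P a.2) / a.1)
      - (u (a.2 + a.1 • ((1 : ℝ), (0 : ℝ))) - u a.2) / a.1 * pdX u (a.2 + a.1 • ((1 : ℝ), (0 : ℝ)))
      - (v (a.2 + a.1 • ((1 : ℝ), (0 : ℝ))) - v a.2) / a.1 * pdY u (a.2 + a.1 • ((1 : ℝ), (0 : ℝ)))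
      - ((pdY P (a.2 + a.1 • ((0 : ℝ), (1 : ℝ))) - pdY P a.2) / a.1)
      - (u (a.2 + a.1 • ((0 : ℝ), (1 : ℝ))) - u a.2) / a.1 * pdX v (a.2 + a.1 • ((0 : ℝ), (1 : ℝ)))
      - (v (a.2 + a.1 • ((0 : ℝ), (1 : ℝ))) - v a.2) / a.1
        * pdY v (a.2 + a.1 • ((0 : ℝ), (1 : ℝ))) :=
    ⟨_, fun _ => rfl⟩
  obtain ⟨c, hc⟩ : ∃ c, c = -pdX (pdX P) p₀ - pdX u p₀ * pdX u p₀ - pdX v p₀ * pdY u p₀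
      - pdY (pdY P) p₀ - pdY u p₀ * pdX v p₀ - pdY v p₀ * pdY v p₀ := ⟨_, rfl⟩
  have hc0 : c ≠ 0 := fun h => hne (by rw [hc] at h; linarith)
  have hshift : ∀ w : ℝ × ℝ, Filter.Tendsto (fun a : ℝ × (ℝ × ℝ) => a.2 + a.1 • w)
      (nhdsWithin 0 (Ioi 0) ×ˢ nhds p₀) (nhds p₀) := fun w => by
    have : Filter.Tendsto (fun a : ℝ × (ℝ × ℝ) => a.2 + a.1 • w)
      (nhds ((0 : ℝ), p₀)) (nhds (p₀ + (0 : ℝ) • w)) :=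
      (by fun_prop : Continuous fun a : ℝ × (ℝ × ℝ) => a.2 + a.1 • w).tendsto (0, p₀)
    rw [zero_smul, add_zero, nhds_prod_eq] at this
    exact this.mono_left (Filter.prod_mono_left _ nhdsWithin_le_nhds)
  have cs : ∀ {f : ℝ × ℝ → ℝ}, Continuous f → ∀ w : ℝ × ℝ,
      Filter.Tendsto (fun a : ℝ × (ℝ × ℝ) => f (a.2 + a.1 • w))
      (nhdsWithin 0 (Ioi 0) ×ˢ nhds p₀) (nhds (f p₀)) := fun hf w =>
    (hf.tendsto p₀).comp (hshift w)
  have hElim : Filter.Tendsto E (nhdsWithin 0 (Ioi 0) ×ˢ nhds p₀) (nhds c) := by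
    rw [funext hE, hc]
    exact ((((((tendsto_diffQuot (contDiff_pdX hP) p₀ (1, 0)).neg.sub
      ((tendsto_diffQuot hu p₀ (1, 0)).mul (cs (continuous_pdX hu) (1, 0)))).sub
      ((tendsto_diffQuot hv p₀ (1, 0)).mul (cs (continuous_pdY hu) (1, 0)))).sub
      (tendsto_diffQuot (contDiff_pdY hP) p₀ (0, 1))).sub
      ((tendsto_diffQuot hu p₀ (0, 1)).mul (cs (continuous_pdX hv) (0, 1)))).sub
      ((tendsto_diffQuot hv p₀ (0, 1)).mul (cs (continuous_pdY hv) (0, 1))))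
  have hgood : ∀ᶠ a : ℝ × (ℝ × ℝ) in nhdsWithin 0 (Ioi 0) ×ˢ nhds p₀,
      (|c| / 2 < |E a| ∧ 0 < a.1) ∧ (a.2 ∈ U ∧ a.2 + a.1 • ((1 : ℝ), (0 : ℝ)) ∈ U ∧
        a.2 + a.1 • ((0 : ℝ), (1 : ℝ)) ∈ U) := by
    have hc' : |c| / 2 < |c| := half_lt_self (abs_pos.2 hc0)
    refine ((hElim.abs.eventually (lt_mem_nhds hc')).and
      (Filter.tendsto_fst.eventually self_mem_nhdsWithin)).and
      ((Filter.tendsto_snd.eventually (hU.mem_nhds hp₀)).and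
        (((hshift _).eventually (hU.mem_nhds hp₀)).and ((hshift _).eventually (hU.mem_nhds hp₀))))
  obtain ⟨pa, hpa, pb, hpb, hab⟩ := Filter.eventually_prod_iff.1 hgood
  obtain ⟨γ, hγ0, ε, hε, hγ⟩ :=
    ContDiffAt.exists_forall_mem_closedBall_exists_eq_forall_mem_Ioo_hasDerivAt₀
      (f := fun p => (u p, v p)) (x₀ := p₀) (hu.prodMk hv).contDiffAt 0
  have hγ' : ∀ t ∈ Ioo (-ε) ε, HasDerivAt γ (u (γ t), v (γ t)) t := by simpa using hγ
  have hγc : ∀ᶠ t in nhds (0 : ℝ), pb (γ t) := by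
    have := (hγ' 0 ⟨by linarith, hε⟩).continuousAt
    refine this.eventually ?_
    rw [hγ0]; exact hpb
  obtain ⟨δ, hδ, hδb⟩ := Metric.eventually_nhds_iff.1 hγc
  obtain ⟨τ, hτ0, hτε, hτδ⟩ : ∃ τ > 0, τ < ε ∧ τ < δ :=
    ⟨min ε δ / 2, by positivity, by have := min_le_left ε δ; linarith [lt_min hε hδ],
      by have := min_le_right ε δ; linarith [lt_min hε hδ]⟩
  have hpbt : ∀ t ∈ Icc 0 τ, pb (γ t) := fun t ht => hδb (by
    rw [Real.dist_eq, sub_zero, abs_of_nonneg ht.1]; linarith [ht.2])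
  have hderiv : ∀ h, pa h → ∀ t ∈ Icc 0 τ, HasDerivAt (fun t => G h (γ t)) (E (h, γ t)) t := by
    intro h hh t ht
    obtain ⟨⟨-, hpos⟩, hU0, hU1, hU2⟩ := hab hh (hpbt t ht)
    simp only at hpos hU0 hU1 hU2
    have hgt := hγ' t ⟨by linarith [ht.1], by linarith [ht.2]⟩
    have hcomp : ∀ {f : ℝ × ℝ → ℝ}, Differentiable ℝ f → ∀ w : ℝ × ℝ,
        HasDerivAt (fun t => f (γ t + w))
          (u (γ t) * pdX f (γ t + w) + v (γ t) * pdY f (γ t + w)) t := by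
      intro f hf w
      have := (hf (γ t + w)).hasFDerivAt.comp_hasDerivAt t (hgt.add_const w)
      rwa [fderiv_eq_pd] at this
    have hcomp0 : ∀ {f : ℝ × ℝ → ℝ}, Differentiable ℝ f → HasDerivAt (fun t => f (γ t))
          (u (γ t) * pdX f (γ t) + v (γ t) * pdY f (γ t)) t := by
      intro f hf
      simpa using hcomp hf 0
    have hd := ((((hcomp hdu (h • ((1 : ℝ), (0 : ℝ)))).sub (hcomp0 hdu)).div_const h).add
      (((hcomp hdv (h • ((0 : ℝ), (1 : ℝ)))).sub (hcomp0 hdv)).div_const h))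
    refine (hd.congr_of_eventuallyEq (Filter.Eventually.of_forall fun s => ?_)).congr_deriv ?_
    · rw [hG]; rfl
    · rw [hE]
      have a1 := hx _ hU0
      have a2 := hx _ hU1
      have a3 := hy _ hU0
      have a4 := hy _ hU2
      have hne' := hpos.ne'
      simp only
      field_simp
      linear_combination a2 - a1 + a4 - a3
  have hmvt : ∀ h, pa h → |c| / 2 * τ ≤ |G h (γ τ) - G h (γ 0)| := by
    intro h hh
    obtain ⟨ξ, hξ, hξe⟩ := exists_hasDerivAt_eq_slope (fun t => G h (γ t)) (fun t => E (h, γ t)) hτ0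
      (fun t ht => (hderiv h hh t ht).continuousAt.continuousWithinAt)
      (fun t ht => hderiv h hh t (Ioo_subset_Icc_self ht))
    have h1 := (hab hh (hpbt ξ (Ioo_subset_Icc_self hξ))).1.1
    simp only [sub_zero] at hξe
    have h2 : G h (γ τ) - G h (γ 0) = E (h, γ ξ) * τ := by rw [hξe]; field_simp
    rw [h2, abs_mul, abs_of_pos hτ0]
    gcongr
  have hGlim : ∀ q ∈ U, Filter.Tendsto (fun h => G h q) (nhdsWithin 0 (Ioi 0)) (nhds 0) := by
    intro q hq
    have hpair : Filter.Tendsto (fun h : ℝ => (h, q)) (nhdsWithin 0 (Ioi 0))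
        (nhdsWithin 0 (Ioi 0) ×ˢ nhds q) := Filter.tendsto_id.prodMk tendsto_const_nhds
    have h1 := ((tendsto_diffQuot hu q (1, 0)).comp hpair).add
      ((tendsto_diffQuot hv q (0, 1)).comp hpair)
    rw [show fderiv ℝ u q (1, 0) + fderiv ℝ v q (0, 1) = 0 from hdiv q hq] at h1
    exact h1.congr fun h => (hG h q).symm
  obtain ⟨h₁, hh₁⟩ := hpa.exists
  have hUτ := (hab hh₁ (hpbt τ ⟨hτ0.le, le_rfl⟩)).2.1
  have hU0 := (hab hh₁ (hpbt 0 ⟨le_rfl, hτ0.le⟩)).2.1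
  have hlim := ((hGlim _ hUτ).sub (hGlim _ hU0)).abs
  have := ge_of_tendsto hlim (hpa.mono fun h hh => hmvt h hh)
  simp at this
  have : 0 < |c| / 2 * τ := by positivity
  linarith

lemma IsPreconnected.subset_of_disjoint_frontier {α : Type*} [TopologicalSpace α] {C U : Set α}
    (hC : IsPreconnected C) (hU : IsOpen U) (hd : Disjoint C (frontier U))
    (hne : (C ∩ U).Nonempty) : C ⊆ U := by
  refine hC.subset_left_of_subset_union hU
    (isClosed_closure (s := U)).isOpen_compl ?_ ?_ hne
  · exact disjoint_compl_right_iff_subset.2 subset_closure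
  · intro p hp
    by_cases h : p ∈ closure U
    · rw [closure_eq_self_union_frontier] at h
      exact h.elim Or.inl fun h' => (disjoint_left.1 hd hp h').elim
    · exact Or.inr h

namespace GenPeriodicFlow

variable {g Patm L d : ℝ} (F : GenPeriodicFlow g Patm L d)

lemma X_add_int_mul (s : ℝ) (n : ℤ) : F.X (s + n * F.T) = F.X s + n * (2 * L) := by
  have hT := F.T_pos.ne'
  have hp : Function.Periodic (fun s => F.X s - 2 * L / F.T * s) F.T := by
    intro s
    simp only [F.X_per]
    field_simp
    ring
  have := hp.int_mul n s
  have e : 2 * L / F.T * (s + n * F.T) = 2 * L / F.T * s + n * (2 * L) := by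
    field_simp
  linarith

lemma isCompact_range_Y : IsCompact (range F.Y) :=
  (show Function.Periodic F.Y F.T from F.Y_per).compact_of_continuous F.T_pos.ne'
    F.Y_smooth.continuous

lemma minη_le (s : ℝ) : F.minη ≤ F.Y s :=
  csInf_le F.isCompact_range_Y.bddBelow (mem_range_self s)

lemma le_maxη (s : ℝ) : F.Y s ≤ F.maxη :=
  le_csSup F.isCompact_range_Y.bddAbove (mem_range_self s)

lemma neg_d_lt_minη : -d < F.minη := by
  obtain ⟨s, hs⟩ := F.isCompact_range_Y.sInf_mem (range_nonempty _)
  rw [minη, ← hs]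
  exact F.S_above_bed s

lemma mem_frontier_iff {p : ℝ × ℝ} :
    p ∈ frontier F.Ω ↔ (∃ s, p = (F.X s, F.Y s)) ∨ p.2 = -d := by
  rw [F.Ω_frontier]
  simp [eq_comm]

lemma surface_mem_frontier (s : ℝ) : (F.X s, F.Y s) ∈ frontier F.Ω :=
  F.mem_frontier_iff.2 (Or.inl ⟨s, rfl⟩)

lemma notMem_frontier {p : ℝ × ℝ} (hp : p ∈ F.Ω) : p ∉ frontier F.Ω := by
  rw [F.Ω_open.frontier_eq]
  exact fun h => h.2 hp

lemma surface_notMem (s : ℝ) : (F.X s, F.Y s) ∉ F.Ω :=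
  fun h => F.notMem_frontier h (F.surface_mem_frontier s)

lemma surface_mem_closure (s : ℝ) : (F.X s, F.Y s) ∈ closure F.Ω :=
  frontier_subset_closure (F.surface_mem_frontier s)

lemma bed_mem_closure (x : ℝ) : (x, -d) ∈ closure F.Ω :=
  frontier_subset_closure (F.mem_frontier_iff.2 (Or.inr rfl))

lemma mem_of_mem_closure {p : ℝ × ℝ} (hp : p ∈ closure F.Ω) :
    p ∈ F.Ω ∨ (∃ s, p = (F.X s, F.Y s)) ∨ p.2 = -d := by
  rw [closure_eq_self_union_frontier] at hp
  exact hp.imp id F.mem_frontier_iff.1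

lemma above_bed {p : ℝ × ℝ} (hp : p ∈ F.Ω) : -d < p.2 := by
  by_contra! h
  obtain ⟨q, hq, hqΩ⟩ := mem_closure_iff.1 (F.surface_mem_closure 0) {q | -d < q.2}
    (isOpen_lt continuous_const continuous_snd) (F.S_above_bed 0)
  obtain ⟨r, hr, hr'⟩ := F.Ω_conn.isPreconnected.intermediate_value hp hqΩ
    continuous_snd.continuousOn ⟨h, le_of_lt hq⟩
  exact F.notMem_frontier hr (F.mem_frontier_iff.2 (Or.inr hr'))

/-- The horizontal strip between the bed and the lowest surface point lies in the fluid. -/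
lemma mem_of_lt_minη {p : ℝ × ℝ} (h1 : -d < p.2) (h2 : p.2 < F.minη) : p ∈ F.Ω := by
  have hC : Convex ℝ {q : ℝ × ℝ | q.2 ∈ Ioo (-d) F.minη} :=
    (convex_Ioo (-d) F.minη).linear_preimage (LinearMap.snd ℝ ℝ ℝ)
  refine hC.isPreconnected.subset_of_disjoint_frontier F.Ω_open ?_ ?_ ⟨h1, h2⟩
  · refine disjoint_left.2 fun q hq hq' => ?_
    rcases F.mem_frontier_iff.1 hq' with ⟨s, rfl⟩ | h
    · exact absurd (F.minη_le s) (not_le.2 hq.2)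
    · exact absurd h hq.1.ne'
  · obtain ⟨q, hq, hqΩ⟩ := mem_closure_iff.1 (F.bed_mem_closure 0) {q | q.2 < F.minη}
      (isOpen_lt continuous_snd continuous_const) F.neg_d_lt_minη
    exact ⟨q, ⟨F.above_bed hqΩ, hq⟩, hqΩ⟩

lemma le_maxη_of_mem (hL : 0 < L) {p : ℝ × ℝ} (hp : p ∈ F.Ω) : p.2 ≤ F.maxη := by
  by_contra! h
  have hmm : F.minη ≤ F.maxη := (F.minη_le 0).trans (F.le_maxη 0)
  have hdm := F.neg_d_lt_minη
  have hC : Convex ℝ {q : ℝ × ℝ | q.2 ∈ Ioi F.maxη} :=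
    (convex_Ioi F.maxη).linear_preimage (LinearMap.snd ℝ ℝ ℝ)
  have hsub : {q : ℝ × ℝ | q.2 ∈ Ioi F.maxη} ⊆ F.Ω := by
    refine hC.isPreconnected.subset_of_disjoint_frontier F.Ω_open ?_ ⟨p, h, hp⟩
    refine disjoint_left.2 fun q hq hq' => ?_
    have hq2 : F.maxη < q.2 := hq
    rcases F.mem_frontier_iff.1 hq' with ⟨s, rfl⟩ | h
    · exact absurd (F.le_maxη s) (not_le.2 hq2)
    · linarith
  have hA : ((0 : ℝ), F.maxη + 1) ∈ F.Ω := hsub (show F.maxη < F.maxη + 1 by linarith)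
  have hB : ((0 : ℝ), (F.minη - d) / 2) ∈ F.Ω :=
    F.mem_of_lt_minη (by simp only; linarith) (by simp only; linarith)
  have hJ : JoinedIn F.Ω ((0 : ℝ), F.maxη + 1) ((0 : ℝ), (F.minη - d) / 2) :=
    (F.Ω_open.isConnected_iff_isPathConnected.1 F.Ω_conn).joinedIn _ hA _ hB
  obtain ⟨γ, hγ⟩ := hJ
  have hmem : ∀ t, γ.extend t ∈ F.Ω := fun t => by
    have : γ.extend t ∈ range γ.extend := mem_range_self t
    rw [γ.extend_range] at this
    obtain ⟨t', ht'⟩ := this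
    exact ht' ▸ hγ t'
  have hbdd : ∃ K : ℝ, ∀ t, |(γ.extend t).1| ≤ K := by
    have hc : IsCompact (range γ.extend) := by
      rw [γ.extend_range]; exact isCompact_range γ.continuous
    obtain ⟨K, hK⟩ := (hc.image continuous_fst).isBounded.exists_norm_le
    exact ⟨K, fun t => hK _ ⟨_, mem_range_self t, rfl⟩⟩
  obtain ⟨K, hK⟩ := hbdd
  obtain ⟨N, hN⟩ := exists_nat_gt ((K + |F.X 0|) / (2 * L))
  have hN' : K + |F.X 0| < N * (2 * L) := (div_lt_iff₀ (by linarith)).1 hN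
  obtain ⟨σ, hσ⟩ : ∃ σ : ℝ → ℝ, σ = fun s => -(N * F.T) + 2 * (N * F.T) * s := ⟨_, rfl⟩
  have hσc : Continuous σ := by rw [hσ]; fun_prop
  have hX1 : F.X (σ 1) = F.X 0 + N * (2 * L) := by
    have := F.X_add_int_mul 0 N
    rw [← Int.cast_natCast (R := ℝ) N, ← this, hσ]; congr 1; push_cast; ring
  have hX0 : F.X (σ 0) = F.X 0 - N * (2 * L) := by
    have := F.X_add_int_mul 0 (-N)
    push_cast at this
    rw [show F.X 0 - N * (2 * L) = F.X 0 + -(N : ℝ) * (2 * L) by ring, ← this, hσ]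
    congr 1; ring
  have hγ0 : γ.extend 0 = (0, F.maxη + 1) := γ.extend_zero
  have hγ1 : γ.extend 1 = (0, (F.minη - d) / 2) := γ.extend_one
  have hXc := F.X_smooth.continuous
  have hYc := F.Y_smooth.continuous
  have hγc := γ.continuous_extend
  obtain ⟨z, hz⟩ := exists_eq_zero_of_opposite_sides
    (H := fun z => ⟨F.X (σ z.2) - (γ.extend z.1).1, F.Y (σ z.2) - (γ.extend z.1).2⟩)
    (by
      have : Continuous fun z : ℝ × ℝ => Complex.equivRealProdCLM.symm
          (F.X (σ z.2) - (γ.extend z.1).1, F.Y (σ z.2) - (γ.extend z.1).2) := by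
        fun_prop
      exact this)
    (fun t _ => by
      simp only [hX1]; linarith [(abs_le.1 (hK t)).2, neg_abs_le (F.X 0)])
    (fun t _ => by
      simp only [hX0]; linarith [(abs_le.1 (hK t)).1, le_abs_self (F.X 0)])
    (fun s _ => by
      simp only [hγ0]; linarith [F.le_maxη (σ s)])
    (fun s _ => by
      simp only [hγ1]; linarith [F.minη_le (σ s)])
  have h1 := congrArg Complex.re hz
  have h2 := congrArg Complex.im hz
  simp only [Complex.zero_re, Complex.zero_im] at h1 h2
  refine F.surface_notMem (σ z.2) ?_
  have : (F.X (σ z.2), F.Y (σ z.2)) = γ.extend z.1 := Prod.ext (by simp only; linarith)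
    (by simp only; linarith)
  rw [this]
  exact hmem _

end GenPeriodicFlow

lemma mem_closure_of_sqDist_le {z p : ℝ × ℝ} {R : ℝ} {U : Set (ℝ × ℝ)} (hR : 0 < R)
    (hU : ∀ p, sqDist p z < R ^ 2 → p ∈ U) (hp : sqDist p z ≤ R ^ 2) : p ∈ closure U := by
  have hc : Continuous fun t : ℝ => (z.1 + t * (p.1 - z.1), z.2 + t * (p.2 - z.2)) := by
    fun_prop
  have ht : Filter.Tendsto (fun t : ℝ => (z.1 + t * (p.1 - z.1), z.2 + t * (p.2 - z.2)))
      (nhdsWithin 1 (Iio 1)) (nhds p) := by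
    have := hc.tendsto 1
    simp only [one_mul, add_sub_cancel] at this
    exact this.mono_left nhdsWithin_le_nhds
  refine mem_closure_of_tendsto ht ?_
  filter_upwards [Ioo_mem_nhdsLT (show (0 : ℝ) < 1 by norm_num)] with t ht'
  refine hU _ ?_
  have e : sqDist (z.1 + t * (p.1 - z.1), z.2 + t * (p.2 - z.2)) z = t ^ 2 * sqDist p z := by
    simp only [sqDist]; ring
  rw [e]
  have h1 : t ^ 2 < 1 := by nlinarith [ht'.1, ht'.2]
  have h0 : 0 < R ^ 2 := by positivity
  have h2 : t ^ 2 * sqDist p z ≤ t ^ 2 * R ^ 2 := mul_le_mul_of_nonneg_left hp (sq_nonneg t)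
  nlinarith

/-- Hopf's lemma at a point `c` of the boundary of a domain `U` having an interior tangent disc at
`c`. -/
lemma hopf_of_interior_disc {f k : ℝ × ℝ → ℝ} (hf : ContDiff ℝ 2 f) {U : Set (ℝ × ℝ)}
    (hk : ContinuousOn k (closure U)) {z c : ℝ × ℝ} {R M : ℝ} (hR : 0 < R)
    (hU : ∀ p, sqDist p z < R ^ 2 → p ∈ U)
    (hlap : ∀ p ∈ U, |pdX (pdX f) p + pdY (pdY f) p| ≤ k p * (|pdX f p| + |pdY f p|))
    (hlt : ∀ p ∈ U, f p < M) (hc : sqDist c z = R ^ 2) (hfc : f c = M) :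
    fderiv ℝ f c (z - c) < 0 := by
  have hcl : {p | sqDist p z ≤ R ^ 2} ⊆ closure U := fun p hp => mem_closure_of_sqDist_le hR hU hp
  obtain ⟨K, hK⟩ := ((isCompact_sqDist_le z (R ^ 2)).image_of_continuousOn
    (hk.mono hcl)).isBounded.exists_norm_le
  have hle : ∀ p ∈ closure U, f p ≤ M :=
    closure_minimal (fun p hp => (hlt p hp).le) (isClosed_le hf.continuous continuous_const)
  refine hopf_boundary_point hf (K := |K|) hR (abs_nonneg K) (fun p hp => ?_)
    (fun p hp => hlt p (hU p hp)) (fun p hp => hle p (hcl hp.le)) hc hfc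
  refine (hlap p (hU p hp)).trans (mul_le_mul_of_nonneg_right ?_ (by positivity))
  exact (le_abs_self _).trans ((hK _ ⟨p, hp.le, rfl⟩).trans (le_abs_self K))

namespace GenPeriodicFlow

variable {g Patm L d : ℝ} (F : GenPeriodicFlow g Patm L d)

lemma add_int_mul_mem_closure {p : ℝ × ℝ} (hp : p ∈ closure F.Ω) (n : ℤ) :
    (p.1 + n * (2 * L), p.2) ∈ closure F.Ω := by
  refine map_mem_closure (f := fun p : ℝ × ℝ => (p.1 + n * (2 * L), p.2)) (by fun_prop) hp ?_
  intro q hq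
  have hper : Function.Periodic (fun x => (x, q.2) ∈ F.Ω) (2 * L) :=
    fun x => propext (F.Ω_per (x, q.2)).symm
  exact (hper.int_mul n q.1).mpr hq

lemma mem_of_sqDist_bed {p : ℝ × ℝ} {x R : ℝ} (hR : R = (F.minη + d) / 4)
    (hp : sqDist p (x, -d + R) < R ^ 2) : p ∈ F.Ω := by
  have hm := F.neg_d_lt_minη
  have hR0 : 0 < R := by linarith
  simp only [sqDist] at hp
  have := abs_lt_of_sq_lt_sq' (show (p.2 - (-d + R)) ^ 2 < R ^ 2 by
    nlinarith [sq_nonneg (p.1 - x)]) hR0.le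
  exact F.mem_of_lt_minη (by linarith [this.1]) (by linarith [this.2])

/-- Maximum principle: a periodic function with `|Δf| ≤ k |∇f|` in the fluid, with vanishing
normal derivative on the bed and nonconstant on the surface, stays strictly below its upper bound
on the surface. -/
lemma lt_of_mem (hL : 0 < L) {f k : ℝ × ℝ → ℝ} {M : ℝ} (hf : ContDiff ℝ 2 f)
    (hper : ∀ x y, f (x + 2 * L, y) = f (x, y)) (hk : ContinuousOn k (closure F.Ω))
    (hlap : ∀ p ∈ F.Ω, |pdX (pdX f) p + pdY (pdY f) p| ≤ k p * (|pdX f p| + |pdY f p|))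
    (hbed : ∀ x, pdY f (x, -d) = 0) (hS : ∀ s, f (F.X s, F.Y s) ≤ M)
    (hnc : ∃ s s', f (F.X s, F.Y s) ≠ f (F.X s', F.Y s')) {p : ℝ × ℝ} (hp : p ∈ F.Ω) :
    f p < M := by
  have hcpt : IsCompact (closure F.Ω ∩ Icc (0 : ℝ) (2 * L) ×ˢ Icc (-d) F.maxη) :=
    (isCompact_Icc.prod isCompact_Icc).inter_left isClosed_closure
  have hdm : -d < F.maxη := F.neg_d_lt_minη.trans_le ((F.minη_le 0).trans (F.le_maxη 0))
  have hbox : ∀ p ∈ closure F.Ω, p.2 ∈ Icc (-d) F.maxη :=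
    closure_minimal (fun p hp => ⟨(F.above_bed hp).le, F.le_maxη_of_mem hL hp⟩)
      (isClosed_Icc.preimage continuous_snd)
  obtain ⟨p₀, hp₀, hmax⟩ := hcpt.exists_isMaxOn
    ⟨(0, -d), F.bed_mem_closure 0, ⟨le_rfl, by simp only; linarith⟩, le_rfl, hdm.le⟩
    hf.continuous.continuousOn
  have hmax' : ∀ p ∈ closure F.Ω, f p ≤ f p₀ := by
    intro p hp
    have hL2 : 0 < 2 * L := by linarith
    obtain ⟨n, hn⟩ : ∃ n : ℤ, p.1 + n * (2 * L) ∈ Icc 0 (2 * L) := by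
      refine ⟨-⌊p.1 / (2 * L)⌋, ?_⟩
      have h1 := (le_div_iff₀ hL2).1 (Int.floor_le (p.1 / (2 * L)))
      have h2 := (div_lt_iff₀ hL2).1 (Int.lt_floor_add_one (p.1 / (2 * L)))
      push_cast
      constructor <;> linarith
    have hfp : f (p.1 + n * (2 * L), p.2) = f p :=
      (show Function.Periodic (fun x => f (x, p.2)) (2 * L) from fun x => hper x p.2).int_mul n p.1
    rw [← hfp]
    exact hmax ⟨F.add_int_mul_mem_closure hp n, hn, hbox p hp⟩
  have hint : ∀ p ∈ F.Ω, f p < f p₀ := by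
    intro p hp
    refine lt_of_le_of_ne (hmax' p (subset_closure hp)) fun hpe => ?_
    have hconst := strong_maximum_principle hf F.Ω_open F.Ω_conn.isPreconnected
      (hk.mono subset_closure) hlap (fun p hp => hmax' p (subset_closure hp)) hp hpe
    have hconst' : ∀ p ∈ closure F.Ω, f p = f p₀ :=
      closure_minimal hconst (isClosed_eq hf.continuous continuous_const)
    obtain ⟨s, s', hss⟩ := hnc
    exact hss ((hconst' _ (F.surface_mem_closure s)).trans
      (hconst' _ (F.surface_mem_closure s')).symm)
  by_contra! hM
  rcases F.mem_of_mem_closure hp₀.1 with h | ⟨s, h⟩ | h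
  · exact lt_irrefl _ (hint p₀ h)
  · have := hint p hp
    have := hS s
    rw [h] at *
    linarith
  · obtain ⟨R, hR⟩ : ∃ R, R = (F.minη + d) / 4 := ⟨_, rfl⟩
    have hm := F.neg_d_lt_minη
    have hopf := hopf_of_interior_disc hf hk (z := (p₀.1, -d + R)) (c := p₀) (R := R)
      (by linarith) (fun p hp => F.mem_of_sqDist_bed hR hp) hlap hint
      (by simp only [sqDist, h]; ring) rfl
    rw [fderiv_eq_pd, show p₀ = (p₀.1, -d) from Prod.ext rfl h, hbed] at hopf
    simp at hopf

/-- The pressure corrected by the hydrostatic term. -/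
def dynPressure (p : ℝ × ℝ) : ℝ := F.P p + g * p.2

lemma contDiff_dynPressure : ContDiff ℝ 2 F.dynPressure :=
  F.P_smooth.add (contDiff_const.mul contDiff_snd)

lemma differentiable_P : Differentiable ℝ F.P := F.P_smooth.differentiable (by norm_num)

lemma pdX_dynPressure : pdX F.dynPressure = pdX F.P := by
  ext p
  refine (hasDerivAt_pdX (F.contDiff_dynPressure.differentiable (by norm_num) p)).unique ?_
  exact (hasDerivAt_pdX (F.differentiable_P p)).add_const (g * p.2)

lemma pdY_dynPressure : pdY F.dynPressure = fun p => pdY F.P p + g := by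
  ext p
  refine (hasDerivAt_pdY (F.contDiff_dynPressure.differentiable (by norm_num) p)).unique ?_
  exact (hasDerivAt_pdY (F.differentiable_P p)).add
    (((hasDerivAt_id p.2).const_mul g).congr_deriv (mul_one g))

lemma pdY_pdY_dynPressure : pdY (pdY F.dynPressure) = pdY (pdY F.P) := by
  rw [pdY_dynPressure]
  ext p
  rw [pdY, fderiv_add_const, pdY]

lemma euler_x_closure {p : ℝ × ℝ} (hp : p ∈ closure F.Ω) :
    F.u p * pdX F.u p + F.v p * pdY F.u p = -pdX F.dynPressure p := by
  have hu := continuous_pdX F.u_smooth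
  have hu' := continuous_pdY F.u_smooth
  have hP := (contDiff_pdX F.P_smooth).continuous
  have := F.u_smooth.continuous
  have := F.v_smooth.continuous
  rw [pdX_dynPressure]
  exact closure_minimal F.euler_x (isClosed_eq (by fun_prop) (by fun_prop)) hp

lemma euler_y_closure {p : ℝ × ℝ} (hp : p ∈ closure F.Ω) :
    F.u p * pdX F.v p + F.v p * pdY F.v p = -pdY F.dynPressure p := by
  have hu := continuous_pdX F.v_smooth
  have hu' := continuous_pdY F.v_smooth
  have hP := (contDiff_pdY F.P_smooth).continuous
  have := F.u_smooth.continuous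
  have := F.v_smooth.continuous
  have h : F.u p * pdX F.v p + F.v p * pdY F.v p = -pdY F.P p - g :=
    closure_minimal F.euler_y (isClosed_eq (by fun_prop) (by fun_prop)) hp
  rw [h, pdY_dynPressure, neg_add, sub_eq_add_neg]

lemma pdY_dynPressure_bed (x : ℝ) : pdY F.dynPressure (x, -d) = 0 := by
  have h := F.euler_y_closure (F.bed_mem_closure x)
  have hv : pdX F.v (x, -d) = 0 := by
    refine (hasDerivAt_pdX (F.v_smooth.differentiable (by norm_num) (x, -d))).unique ?_
    simp only [F.bed_kinematic]
    exact hasDerivAt_const _ _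
  rw [F.bed_kinematic, hv] at h
  linarith

/-- The coefficient bounding the Laplacian of the dynamic pressure by its gradient. -/
noncomputable def gradCoeff (p : ℝ × ℝ) : ℝ :=
  2 * (|F.u p * pdY F.v p - F.v p * pdX F.v p| + |F.u p * pdY F.u p - F.v p * pdX F.u p|) /
    (F.u p ^ 2 + F.v p ^ 2)

lemma continuousOn_gradCoeff (hstag : ∀ p ∈ closure F.Ω, F.u p ^ 2 + F.v p ^ 2 ≠ 0) :
    ContinuousOn F.gradCoeff (closure F.Ω) := by
  have h1 := continuous_pdX F.v_smooth
  have h2 := continuous_pdY F.v_smooth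
  have h3 := continuous_pdX F.u_smooth
  have h4 := continuous_pdY F.u_smooth
  have h5 := F.u_smooth.continuous
  have h6 := F.v_smooth.continuous
  exact ContinuousOn.div (by fun_prop) (by fun_prop) hstag

lemma abs_laplacian_dynPressure_le (hstag : ∀ p ∈ closure F.Ω, F.u p ^ 2 + F.v p ^ 2 ≠ 0)
    {p : ℝ × ℝ} (hp : p ∈ F.Ω) :
    |pdX (pdX F.dynPressure) p + pdY (pdY F.dynPressure) p| ≤
      F.gradCoeff p * (|pdX F.dynPressure p| + |pdY F.dynPressure p|) := by
  have hx := F.euler_x_closure (subset_closure hp)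
  have hy := F.euler_y_closure (subset_closure hp)
  have hdiv := F.incompressible p hp
  have hΔ := laplacian_pressure F.u_smooth F.v_smooth F.P_smooth F.Ω_open F.euler_x F.euler_y
    F.incompressible hp
  have hpos : 0 < F.u p ^ 2 + F.v p ^ 2 :=
    lt_of_le_of_ne (by positivity) (hstag p (subset_closure hp)).symm
  rw [pdY_pdY_dynPressure, congrArg pdX F.pdX_dynPressure, hΔ, gradCoeff, div_mul_eq_mul_div,
    le_div_iff₀ hpos]
  nth_rewrite 1 [← abs_of_pos hpos]
  rw [← abs_mul]
  obtain ⟨a, ha⟩ : ∃ a, a = F.u p * pdY F.v p - F.v p * pdX F.v p := ⟨_, rfl⟩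
  obtain ⟨b, hb⟩ : ∃ b, b = F.u p * pdY F.u p - F.v p * pdX F.u p := ⟨_, rfl⟩
  have hv : pdY F.v p = -pdX F.u p := by linarith
  have e : -(pdX F.u p ^ 2 + 2 * (pdY F.u p * pdX F.v p) + pdY F.v p ^ 2) *
      (F.u p ^ 2 + F.v p ^ 2) =
      2 * (-(a * pdX F.dynPressure p) + b * pdY F.dynPressure p) := by
    rw [ha, hb, ← neg_eq_iff_eq_neg.2 hx, ← neg_eq_iff_eq_neg.2 hy, hv]; ring
  rw [e, ← ha, ← hb, abs_mul, abs_two]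
  have h1 := abs_add_le (-(a * pdX F.dynPressure p)) (b * pdY F.dynPressure p)
  rw [abs_neg, abs_mul, abs_mul] at h1
  have h2 := mul_nonneg (abs_nonneg a) (abs_nonneg (pdY F.dynPressure p))
  have h3 := mul_nonneg (abs_nonneg b) (abs_nonneg (pdX F.dynPressure p))
  linarith

lemma dynPressure_periodic (x y : ℝ) : F.dynPressure (x + 2 * L, y) = F.dynPressure (x, y) := by
  simp only [dynPressure, F.P_periodic]

lemma dynPressure_surface (s : ℝ) : F.dynPressure (F.X s, F.Y s) = Patm + g * F.Y s := by
  simp only [dynPressure, F.surface_pressure]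

lemma dynPressure_surface_ne (hg : 0 < g) (hnt : F.Nontrivial') :
    ∃ s s', F.dynPressure (F.X s, F.Y s) ≠ F.dynPressure (F.X s', F.Y s') := by
  obtain ⟨s, s', h⟩ := hnt
  refine ⟨s, s', fun h' => h ?_⟩
  rw [dynPressure_surface, dynPressure_surface] at h'
  exact mul_left_cancel₀ hg.ne' (by linarith)

lemma dynPressure_lt (hg : 0 < g) (hL : 0 < L) (hnt : F.Nontrivial')
    (hstag : ∀ p ∈ closure F.Ω, F.u p ^ 2 + F.v p ^ 2 ≠ 0) {p : ℝ × ℝ} (hp : p ∈ F.Ω) :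
    F.dynPressure p < Patm + g * F.maxη := by
  refine F.lt_of_mem hL F.contDiff_dynPressure F.dynPressure_periodic
    (F.continuousOn_gradCoeff hstag) (fun p hp => F.abs_laplacian_dynPressure_le hstag hp)
    F.pdY_dynPressure_bed (fun s => ?_) (F.dynPressure_surface_ne hg hnt) hp
  rw [dynPressure_surface]
  nlinarith [F.le_maxη s]

lemma abs_laplacian_neg_dynPressure_le (hstag : ∀ p ∈ closure F.Ω, F.u p ^ 2 + F.v p ^ 2 ≠ 0)
    {p : ℝ × ℝ} (hp : p ∈ F.Ω) :
    |pdX (pdX fun q => -F.dynPressure q) p + pdY (pdY fun q => -F.dynPressure q) p| ≤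
      F.gradCoeff p * (|pdX (fun q => -F.dynPressure q) p| +
        |pdY (fun q => -F.dynPressure q) p|) := by
  rw [funext (pdX_neg F.dynPressure), funext (pdY_neg F.dynPressure), pdX_neg, pdY_neg, abs_neg,
    abs_neg, ← neg_add, abs_neg]
  exact F.abs_laplacian_dynPressure_le hstag hp

lemma lt_dynPressure (hg : 0 < g) (hL : 0 < L) (hnt : F.Nontrivial')
    (hstag : ∀ p ∈ closure F.Ω, F.u p ^ 2 + F.v p ^ 2 ≠ 0) {p : ℝ × ℝ} (hp : p ∈ F.Ω) :
    Patm + g * F.minη < F.dynPressure p := by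
  rw [← neg_lt_neg_iff]
  refine F.lt_of_mem hL (f := fun q => -F.dynPressure q) F.contDiff_dynPressure.neg
    (fun x y => by rw [dynPressure_periodic]) (F.continuousOn_gradCoeff hstag)
    (fun p hp => F.abs_laplacian_neg_dynPressure_le hstag hp)
    (fun x => by rw [pdY_neg, pdY_dynPressure_bed, neg_zero]) (fun s => ?_) ?_ hp
  · rw [dynPressure_surface]
    nlinarith [F.minη_le s]
  · obtain ⟨s, s', h⟩ := F.dynPressure_surface_ne hg hnt
    exact ⟨s, s', fun h' => h (neg_injective h')⟩

lemma pdY_dynPressure_trough (hg : 0 < g) (hL : 0 < L) (hnt : F.Nontrivial')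
    (hstag : ∀ p ∈ closure F.Ω, F.u p ^ 2 + F.v p ^ 2 ≠ 0) {s₀ : ℝ} (hs : F.Y s₀ = F.minη) :
    pdY F.dynPressure (F.X s₀, F.Y s₀) < 0 := by
  have hm := F.neg_d_lt_minη
  obtain ⟨R, hR⟩ : ∃ R, R = (F.minη + d) / 4 := ⟨_, rfl⟩
  have hR0 : 0 < R := by linarith
  have hopf := hopf_of_interior_disc (f := fun q => -F.dynPressure q) F.contDiff_dynPressure.neg
    (F.continuousOn_gradCoeff hstag) (U := F.Ω) (z := (F.X s₀, F.minη - R))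
    (c := (F.X s₀, F.Y s₀)) (R := R) (M := -(Patm + g * F.minη)) hR0 ?_
    (fun p hp => F.abs_laplacian_neg_dynPressure_le hstag hp)
    (fun p hp => neg_lt_neg (F.lt_dynPressure hg hL hnt hstag hp))
    (by simp only [sqDist, hs]; ring) (by rw [dynPressure_surface, hs])
  · rw [fderiv_eq_pd, pdY_neg] at hopf
    simp only [Prod.fst_sub, Prod.snd_sub, hs] at hopf
    rw [hs]
    nlinarith
  · intro p hp
    simp only [sqDist] at hp
    have := abs_lt_of_sq_lt_sq' (show (p.2 - (F.minη - R)) ^ 2 < R ^ 2 by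
      nlinarith [sq_nonneg (p.1 - F.X s₀)]) hR0.le
    exact F.mem_of_lt_minη (by linarith [this.1]) (by linarith [this.2])

end GenPeriodicFlow

/-- A germ of a `C²` function extends to a globally `C²` function. -/
lemma exists_contDiff_eventuallyEq {φ : ℝ → ℝ} {x : ℝ} (h : ContDiffAt ℝ 2 φ x) :
    ∃ ψ : ℝ → ℝ, ContDiff ℝ 2 ψ ∧ ψ =ᶠ[nhds x] φ := by
  obtain ⟨r, hr, hφ⟩ := Metric.eventually_nhds_iff_ball.1 (h.eventually (by simp))
  let b : ContDiffBump x := ⟨r / 3, r / 2, by linarith, by linarith⟩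
  refine ⟨fun y => b y * φ y, contDiff_iff_contDiffAt.2 fun y => ?_, ?_⟩
  · by_cases hy : y ∈ Metric.ball x r
    · exact b.contDiffAt.mul (hφ y hy)
    · refine (contDiffAt_const (c := (0 : ℝ))).congr_of_eventuallyEq ?_
      have hy' : r / 2 < dist y x := by
        rw [Metric.mem_ball, not_lt] at hy
        linarith
      filter_upwards [(isOpen_lt (f := fun _ : ℝ => r / 2) (g := fun z => dist z x) (by fun_prop)
        (by fun_prop)).mem_nhds hy'] with z hz
      rw [b.zero_of_le_dist (le_of_lt hz), zero_mul]
  · filter_upwards [b.eventuallyEq_one] with y hy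
    rw [hy, Pi.one_apply, one_mul]

/-- A regular plane curve is locally a graph where its tangent is not vertical. -/
lemma exists_local_graph {X Y : ℝ → ℝ} (hX : ContDiff ℝ 2 X) (hY : ContDiff ℝ 2 Y) {s₀ : ℝ}
    (h : deriv X s₀ ≠ 0) :
    ∃ ε > 0, ∃ η : ℝ → ℝ, ContDiff ℝ 2 η ∧ ∀ s, |s - s₀| < ε → Y s = η (X s) := by
  have hd : HasDerivAt X (deriv X s₀) s₀ := (hX.differentiable (by norm_num) s₀).hasDerivAt
  have he := hd.hasFDerivAt_equiv h
  have hXa : ContDiffAt ℝ 2 X s₀ := hX.contDiffAt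
  have hξ := hXa.to_localInverse he two_ne_zero
  have hφ : ContDiffAt ℝ 2 (fun x => Y (hXa.localInverse he two_ne_zero x)) (X s₀) :=
    hY.contDiffAt.comp _ hξ
  obtain ⟨η, hη, hηφ⟩ := exists_contDiff_eventuallyEq hφ
  have hinv : ∀ᶠ s in nhds s₀, hXa.localInverse he two_ne_zero (X s) = s :=
    (hXa.hasStrictFDerivAt' he two_ne_zero).eventually_left_inverse
  obtain ⟨ε, hε, hball⟩ := Metric.eventually_nhds_iff.1
    (hinv.and (hX.continuous.continuousAt.eventually hηφ))
  refine ⟨ε, hε, η, hη, fun s hs => ?_⟩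
  obtain ⟨h1, h2⟩ := hball (by rwa [Real.dist_eq])
  simp only [h1] at h2
  exact h2.symm

lemma hasDerivAt_deriv_of_contDiff_two {f : ℝ → ℝ} (hf : ContDiff ℝ 2 f) (x : ℝ) :
    HasDerivAt (deriv f) (deriv (deriv f) x) x :=
  (((contDiff_succ_iff_deriv (n := 1)).1 hf).2.2.differentiable (by norm_num) x).hasDerivAt

lemma hasDerivAt_of_contDiff_two {f : ℝ → ℝ} (hf : ContDiff ℝ 2 f) (x : ℝ) :
    HasDerivAt f (deriv f x) x :=
  (hf.differentiable (by norm_num) x).hasDerivAt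

lemma graph_derivatives {X Y η : ℝ → ℝ} (hX : ContDiff ℝ 2 X) (hη : ContDiff ℝ 2 η) {s₀ ε : ℝ}
    (hε : 0 < ε) (hg : ∀ s, |s - s₀| < ε → Y s = η (X s)) (hXd : deriv X s₀ ≠ 0)
    (hYd : deriv Y s₀ = 0) : deriv η (X s₀) = 0 ∧
      deriv (deriv Y) s₀ = deriv (deriv η) (X s₀) * deriv X s₀ ^ 2 := by
  have hYη : Y =ᶠ[nhds s₀] fun s => η (X s) := by
    filter_upwards [Metric.ball_mem_nhds s₀ hε] with s hs
    exact hg s (by rwa [Metric.mem_ball, Real.dist_eq] at hs)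
  have hc : ∀ s, HasDerivAt (fun s => η (X s)) (deriv η (X s) * deriv X s) s := fun s =>
    (hasDerivAt_of_contDiff_two hη (X s)).comp s (hasDerivAt_of_contDiff_two hX s)
  have h0 : deriv η (X s₀) = 0 := by
    rw [hYη.deriv_eq, (hc s₀).deriv] at hYd
    exact (mul_eq_zero.1 hYd).resolve_right hXd
  refine ⟨h0, ?_⟩
  rw [hYη.deriv.deriv_eq, funext fun s => (hc s).deriv]
  have h2 := ((hasDerivAt_deriv_of_contDiff_two hη (X s₀)).comp s₀
    (hasDerivAt_of_contDiff_two hX s₀)).mul (hasDerivAt_deriv_of_contDiff_two hX s₀)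
  refine (show HasDerivAt (fun s => deriv η (X s) * deriv X s) _ _ from h2).deriv.trans ?_
  simp only [Function.comp_apply, h0]
  ring

lemma exists_parabola_le {η : ℝ → ℝ} {x₀ : ℝ} (hη : ContDiff ℝ 2 η) (h0 : deriv η x₀ = 0) :
    ∃ C ≥ 1, ∃ r > 0, ∀ x, |x - x₀| < r → η x₀ - C * (x - x₀) ^ 2 ≤ η x := by
  obtain ⟨C, hC⟩ : ∃ C, C = |deriv (deriv η) x₀| / 2 + 1 := ⟨_, rfl⟩
  have hd : ∀ x, HasDerivAt (fun x => η x + C * (x - x₀) ^ 2)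
      (deriv η x + 2 * C * (x - x₀)) x := fun x =>
    ((hasDerivAt_of_contDiff_two hη x).add ((((hasDerivAt_id x).sub_const x₀).pow 2).const_mul
      C)).congr_deriv (by simp; ring)
  have hdd : HasDerivAt (fun x => deriv η x + 2 * C * (x - x₀))
      (deriv (deriv η) x₀ + 2 * C) x₀ :=
    ((hasDerivAt_deriv_of_contDiff_two hη x₀).add (((hasDerivAt_id x₀).sub_const x₀).const_mul
      (2 * C))).congr_deriv (by simp)
  have hmin : IsLocalMin (fun x => η x + C * (x - x₀) ^ 2) x₀ := by
    refine isLocalMin_of_deriv_deriv_pos ?_ ?_ (hd x₀).continuousAt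
    · rw [funext fun x => (hd x).deriv, hdd.deriv]
      linarith [neg_abs_le (deriv (deriv η) x₀)]
    · rw [(hd x₀).deriv, h0]; ring
  obtain ⟨r, hr, hb⟩ := Metric.eventually_nhds_iff.1 hmin
  refine ⟨C, by linarith [abs_nonneg (deriv (deriv η) x₀)], r, hr, fun x hx => ?_⟩
  have := hb (show dist x x₀ < r by rwa [Real.dist_eq])
  simp only [sub_self] at this
  linarith

namespace GenPeriodicFlow

variable {g Patm L d : ℝ} (F : GenPeriodicFlow g Patm L d)

lemma surface_isolated (hL : 0 < L) (s₀ : ℝ) {ε : ℝ} (hε : 0 < ε) :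
    ∃ δ > 0, ∀ s, |F.X s - F.X s₀| < δ → |F.Y s - F.Y s₀| < δ → |s - s₀| < ε := by
  have hT := F.T_pos
  have hXc := F.X_smooth.continuous
  have hYc := F.Y_smooth.continuous
  have hp : Function.Periodic (fun s => F.X s - 2 * L / F.T * s) F.T := by
    intro s
    simp only [F.X_per]
    field_simp
    ring
  obtain ⟨K, hK⟩ := (hp.compact_of_continuous hT.ne' (by fun_prop)).isBounded.exists_norm_le
  have hK' : ∀ s, |F.X s - 2 * L / F.T * s| ≤ K := fun s => hK _ (mem_range_self s)
  obtain ⟨A, hA⟩ : ∃ A, A = (1 + 2 * K) * F.T / (2 * L) := ⟨_, rfl⟩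
  have hcpt : IsCompact {s | |s - s₀| ≤ A ∧ ε ≤ |s - s₀|} := by
    refine (isCompact_closedBall s₀ A).of_isClosed_subset ?_ fun s hs => ?_
    · exact (isClosed_le (f := fun s => |s - s₀|) (by fun_prop) continuous_const).inter
        (isClosed_le (g := fun s => |s - s₀|) continuous_const (by fun_prop))
    · rw [Metric.mem_closedBall, Real.dist_eq]; exact hs.1
  obtain ⟨m, hm, hmle⟩ := hcpt.exists_forall_le' (a := 0)
    (f := fun s => |F.X s - F.X s₀| + |F.Y s - F.Y s₀|) (by fun_prop) (fun s hs => by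
      refine lt_of_le_of_ne (by positivity) fun h0 => ?_
      have hx : F.X s = F.X s₀ := by
        have := abs_nonneg (F.Y s - F.Y s₀)
        exact sub_eq_zero.1 (abs_eq_zero.1 (le_antisymm (by linarith) (abs_nonneg _)))
      have hy : F.Y s = F.Y s₀ := by
        have := abs_nonneg (F.X s - F.X s₀)
        exact sub_eq_zero.1 (abs_eq_zero.1 (le_antisymm (by linarith) (abs_nonneg _)))
      obtain ⟨n, hn⟩ := F.S_simple s₀ s hx.symm hy.symm
      have hXn := F.X_add_int_mul s₀ n
      rw [← hn, hx] at hXn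
      have hn0 : (n : ℝ) = 0 := by
        have : (n : ℝ) * (2 * L) = 0 := by linarith
        exact (mul_eq_zero.1 this).resolve_right (by linarith)
      rw [hn0, zero_mul, add_zero] at hn
      have := hs.2
      rw [hn, sub_self, abs_zero] at this
      linarith)
  refine ⟨min 1 (m / 2), by positivity, fun s hX hY => ?_⟩
  have hX1 := hX.trans_le (min_le_left _ _)
  have hX2 := hX.trans_le (min_le_right _ _)
  have hY2 := hY.trans_le (min_le_right _ _)
  by_contra! hs
  have hsA : |s - s₀| ≤ A := by
    have h1 : |2 * L / F.T * (s - s₀)| ≤ 1 + 2 * K := by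
      have e : 2 * L / F.T * (s - s₀) = (F.X s - F.X s₀) - (F.X s - 2 * L / F.T * s) +
        (F.X s₀ - 2 * L / F.T * s₀) := by ring
      rw [e]
      refine (abs_add_le _ _).trans ?_
      have := abs_sub (F.X s - F.X s₀) (F.X s - 2 * L / F.T * s)
      linarith [hK' s, hK' s₀]
    rw [abs_mul, abs_of_pos (by positivity)] at h1
    rw [hA, le_div_iff₀ (by linarith)]
    rw [div_mul_eq_mul_div, div_le_iff₀ hT] at h1
    linarith
  have := hmle s ⟨hsA, hs⟩
  linarith

/-- The region below a parabola touching the surface from below at a crest is locally fluid. -/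
lemma exists_parabolic_region (hL : 0 < L) {s₀ ε : ℝ} (hs : F.Y s₀ = F.maxη) (hε : 0 < ε)
    {η : ℝ → ℝ} (hη : ContDiff ℝ 2 η) (hg : ∀ s, |s - s₀| < ε → F.Y s = η (F.X s))
    (h0 : deriv η (F.X s₀) = 0) :
    ∃ C ≥ 1, ∃ r > 0, ∀ p : ℝ × ℝ, |p.1 - F.X s₀| < r → F.Y s₀ - r < p.2 →
      p.2 < F.Y s₀ - C * (p.1 - F.X s₀) ^ 2 → p ∈ F.Ω := by
  obtain ⟨C, hC, r₁, hr₁, hpar⟩ := exists_parabola_le hη h0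
  rw [← hg s₀ (by simpa using hε)] at hpar
  obtain ⟨δ₁, hδ₁, hiso⟩ := F.surface_isolated hL s₀ hε
  have hbed := F.S_above_bed s₀
  obtain ⟨δ, hδ, hδ1, hδb⟩ : ∃ δ > 0, δ ≤ δ₁ ∧ δ ≤ F.Y s₀ + d :=
    ⟨min δ₁ (F.Y s₀ + d), lt_min hδ₁ (by linarith), min_le_left _ _, min_le_right _ _⟩
  obtain ⟨r, hr, hrr, hrδ, hr1, hrC⟩ : ∃ r > 0, r ≤ r₁ ∧ r ≤ δ ∧ r ≤ 1 ∧ C * r ≤ δ / 2 := by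
    refine ⟨min (min r₁ δ) (min 1 (δ / (2 * C))), by positivity,
      (min_le_left _ _).trans (min_le_left _ _), (min_le_left _ _).trans (min_le_right _ _),
      (min_le_right _ _).trans (min_le_left _ _), ?_⟩
    have : min (min r₁ δ) (min 1 (δ / (2 * C))) ≤ δ / (2 * C) :=
      (min_le_right _ _).trans (min_le_right _ _)
    rw [le_div_iff₀ (by linarith)] at this
    linarith
  have hsurf : ∀ s, |F.X s - F.X s₀| < r → F.Y s₀ - δ < F.Y s → F.Y s = η (F.X s) := by
    intro s h1 h2
    have h3 := F.le_maxη s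
    refine hg s (hiso s (by linarith) (abs_lt.2 ⟨by linarith, by linarith⟩))
  have hCx : ∀ x, |x - F.X s₀| < r → C * (x - F.X s₀) ^ 2 ≤ δ / 2 := by
    intro x hx
    have h1 : (x - F.X s₀) ^ 2 ≤ r := by
      rw [← sq_abs]
      nlinarith [abs_nonneg (x - F.X s₀)]
    have := mul_le_mul_of_nonneg_left h1 (show 0 ≤ C by linarith)
    linarith
  obtain ⟨W, hW⟩ : ∃ W : Set (ℝ × ℝ), W = {p | |p.1 - F.X s₀| < r ∧ F.Y s₀ - δ < p.2 ∧
    p.2 < F.Y s₀ - C * (p.1 - F.X s₀) ^ 2} := ⟨_, rfl⟩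
  have hWc : Convex ℝ W := by
    rw [hW]
    rintro p ⟨hp1, hp2, hp3⟩ q ⟨hq1, hq2, hq3⟩ a b ha hb hab
    rw [abs_lt] at hp1 hq1
    have hb' : b = 1 - a := by linarith
    simp only [mem_ofPred_eq, Prod.fst_add, Prod.snd_add, Prod.smul_fst, Prod.smul_snd, smul_eq_mul]
    have hlin : ∀ {c e₁ e₂ : ℝ}, c < e₁ → c < e₂ → c < a * e₁ + b * e₂ := by
      intro c e₁ e₂ h1 h2
      have := (convex_Ioi c) (mem_Ioi.2 h1) (mem_Ioi.2 h2) ha hb hab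
      simpa using this
    have hlin' : ∀ {c e₁ e₂ : ℝ}, e₁ < c → e₂ < c → a * e₁ + b * e₂ < c := by
      intro c e₁ e₂ h1 h2
      have := (convex_Iio c) (mem_Iio.2 h1) (mem_Iio.2 h2) ha hb hab
      simpa using this
    refine ⟨abs_lt.2 ⟨?_, ?_⟩, hlin hp2 hq2, ?_⟩
    · have := hlin (c := F.X s₀ - r) (e₁ := p.1) (e₂ := q.1) (by linarith) (by linarith)
      linarith
    · have := hlin' (c := F.X s₀ + r) (e₁ := p.1) (e₂ := q.1) (by linarith) (by linarith)
      linarith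
    · have h1 := hlin' (c := F.Y s₀) (e₁ := p.2 + C * (p.1 - F.X s₀) ^ 2)
        (e₂ := q.2 + C * (q.1 - F.X s₀) ^ 2) (by linarith) (by linarith)
      have h2 : C * (a * p.1 + b * q.1 - F.X s₀) ^ 2 = a * (C * (p.1 - F.X s₀) ^ 2) +
          b * (C * (q.1 - F.X s₀) ^ 2) - a * b * (C * (p.1 - q.1) ^ 2) := by
        rw [hb']; ring
      have h3 : 0 ≤ a * b * (C * (p.1 - q.1) ^ 2) := by positivity
      linarith
  have hWf : Disjoint W (frontier F.Ω) := by
    rw [hW]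
    refine disjoint_left.2 fun p hp hp' => ?_
    obtain ⟨h1, h2, h3⟩ := hp
    rcases F.mem_frontier_iff.1 hp' with ⟨s, rfl⟩ | h
    · simp only at h1 h2 h3
      have h4 := hsurf s h1 h2
      have h5 := hpar (F.X s) (by linarith)
      linarith
    · linarith
  have hWne : (W ∩ F.Ω).Nonempty := by
    obtain ⟨p, ⟨hpx, hpy⟩, hp⟩ := mem_closure_iff.1 (F.surface_mem_closure s₀)
      ({p : ℝ × ℝ | |p.1 - F.X s₀| < r} ∩ {p | F.Y s₀ - δ / 2 < p.2})
      ((isOpen_lt (by fun_prop) continuous_const).inter (isOpen_lt continuous_const continuous_snd))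
      ⟨by simpa using hr, by simp only [mem_ofPred_eq]; linarith⟩
    simp only [mem_ofPred_eq] at hpx hpy
    have hvert : ∀ I : Set ℝ, I.OrdConnected → p.2 ∈ I → (∀ y ∈ I, -d < y) →
        (∀ s, F.X s = p.1 → F.Y s ∉ I) → ∀ y ∈ I, (p.1, y) ∈ F.Ω := by
      intro I hI hpI hIb hIS y hy
      have hpre : IsPreconnected ((fun y => (p.1, y)) '' I) :=
        hI.isPreconnected.image _ (by fun_prop)
      refine hpre.subset_of_disjoint_frontier F.Ω_open ?_ ⟨p, ⟨p.2, hpI, rfl⟩, hp⟩ ⟨y, hy, rfl⟩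
      refine disjoint_left.2 fun q hq hq' => ?_
      obtain ⟨t, ht, rfl⟩ := hq
      rcases F.mem_frontier_iff.1 hq' with ⟨s, h⟩ | h
      · rw [Prod.mk.injEq] at h
        exact hIS s h.1.symm (h.2 ▸ ht)
      · exact absurd h (hIb t ht).ne'
    have hlt : p.2 < η p.1 := by
      by_contra! hle
      have := hvert (Ici p.2) ordConnected_Ici self_mem_Ici
        (fun y hy => (F.above_bed hp).trans_le hy) (fun s hsx hsy => by
          have h1 : p.2 ≤ F.Y s := hsy
          have h2 := hsurf s (by rwa [hsx]) (by linarith)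
          rw [hsx] at h2
          refine F.surface_notMem s ?_
          rw [show (F.X s, F.Y s) = p from Prod.ext hsx (by simp only; linarith)]
          exact hp) (F.maxη + 1) (by
            have := F.le_maxη_of_mem hL hp
            rw [mem_Ici]; linarith)
      have := F.le_maxη_of_mem hL this
      simp only at this
      linarith
    refine ⟨(p.1, F.Y s₀ - 3 * δ / 4), ?_, ?_⟩
    · rw [hW]
      have := hCx p.1 hpx
      refine ⟨hpx, ?_, ?_⟩ <;> simp only <;> linarith
    · refine hvert (Ioc (F.Y s₀ - δ) p.2) ordConnected_Ioc ⟨by linarith, le_rfl⟩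
        (fun y hy => by linarith [hy.1]) (fun s hsx hsy => ?_) _ ⟨by linarith, by linarith⟩
      have h2 := hsurf s (by rwa [hsx]) hsy.1
      rw [hsx] at h2
      linarith [hsy.2]
  have hWΩ := hWc.isPreconnected.subset_of_disjoint_frontier F.Ω_open hWf hWne
  refine ⟨C, hC, r, hr, fun p h1 h2 h3 => hWΩ ?_⟩
  rw [hW]
  exact ⟨h1, by linarith, h3⟩

lemma pdY_dynPressure_crest (hg : 0 < g) (hL : 0 < L) (hnt : F.Nontrivial')
    (hstag : ∀ p ∈ closure F.Ω, F.u p ^ 2 + F.v p ^ 2 ≠ 0) {s₀ ε : ℝ} (hs : F.Y s₀ = F.maxη)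
    (hε : 0 < ε) {η : ℝ → ℝ} (hη : ContDiff ℝ 2 η)
    (hgr : ∀ s, |s - s₀| < ε → F.Y s = η (F.X s)) (h0 : deriv η (F.X s₀) = 0) :
    0 < pdY F.dynPressure (F.X s₀, F.Y s₀) := by
  obtain ⟨C, hC, r, hr, hreg⟩ := F.exists_parabolic_region hL hs hε hη hgr h0
  obtain ⟨R, hR, hRr, hRC⟩ : ∃ R > 0, 2 * R ≤ r ∧ 2 * R * C ≤ 1 := by
    refine ⟨min (r / 2) (1 / (2 * C)), by positivity, ?_, ?_⟩
    · linarith [min_le_left (r / 2) (1 / (2 * C))]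
    · have := min_le_right (r / 2) (1 / (2 * C))
      rw [le_div_iff₀ (by linarith)] at this
      linarith
  have hopf := hopf_of_interior_disc F.contDiff_dynPressure (F.continuousOn_gradCoeff hstag)
    (U := F.Ω) (z := (F.X s₀, F.Y s₀ - R)) (c := (F.X s₀, F.Y s₀)) (R := R)
    (M := Patm + g * F.maxη) hR ?_ (fun p hp => F.abs_laplacian_dynPressure_le hstag hp)
    (fun p hp => F.dynPressure_lt hg hL hnt hstag hp) (by simp only [sqDist]; ring)
    (by rw [dynPressure_surface, hs])
  · rw [fderiv_eq_pd] at hopf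
    simp only [Prod.fst_sub, Prod.snd_sub] at hopf
    nlinarith
  · intro p hp
    simp only [sqDist] at hp
    have hy := abs_lt_of_sq_lt_sq' (show (p.2 - (F.Y s₀ - R)) ^ 2 < R ^ 2 by
      nlinarith [sq_nonneg (p.1 - F.X s₀)]) hR.le
    have hx := abs_lt_of_sq_lt_sq (show (p.1 - F.X s₀) ^ 2 < R ^ 2 by
      nlinarith [sq_nonneg (p.2 - (F.Y s₀ - R))]) hR.le
    refine hreg p (by linarith) (by linarith [hy.1]) ?_
    have h1 : (p.1 - F.X s₀) ^ 2 < 2 * R * (F.Y s₀ - p.2) := by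
      nlinarith [sq_nonneg (F.Y s₀ - p.2)]
    have h2 : 0 < F.Y s₀ - p.2 := by linarith [hy.2]
    have h3 := mul_lt_mul_of_pos_left h1 (show 0 < C by linarith)
    nlinarith

lemma sq_mul_curvature {s₀ ε : ℝ} (hε : 0 < ε) {η : ℝ → ℝ} (hη : ContDiff ℝ 2 η)
    (hgr : ∀ s, |s - s₀| < ε → F.Y s = η (F.X s)) (hYd : deriv F.Y s₀ = 0) :
    F.u (F.X s₀, F.Y s₀) ^ 2 * deriv (deriv η) (F.X s₀) =
      -pdY F.dynPressure (F.X s₀, F.Y s₀) := by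
  have hXd : deriv F.X s₀ ≠ 0 := fun h => F.regular s₀ (by rw [h, hYd]; ring)
  have hv : F.v (F.X s₀, F.Y s₀) = 0 := by
    have := F.surface_tangency s₀
    rw [hYd, mul_zero] at this
    exact (mul_eq_zero.1 this.symm).resolve_right hXd
  have hc : HasDerivAt (fun s => (F.X s, F.Y s)) (deriv F.X s₀, deriv F.Y s₀) s₀ :=
    (hasDerivAt_of_contDiff_two F.X_smooth s₀).prodMk (hasDerivAt_of_contDiff_two F.Y_smooth s₀)
  have hud := ((F.u_smooth.differentiable (by norm_num)
    (F.X s₀, F.Y s₀)).hasFDerivAt.comp_hasDerivAt s₀ hc).mul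
    (hasDerivAt_deriv_of_contDiff_two F.Y_smooth s₀)
  have hvd := ((F.v_smooth.differentiable (by norm_num)
    (F.X s₀, F.Y s₀)).hasFDerivAt.comp_hasDerivAt s₀ hc).mul
    (hasDerivAt_deriv_of_contDiff_two F.X_smooth s₀)
  have hfun : (F.u ∘ fun s => (F.X s, F.Y s)) * deriv F.Y =
      (F.v ∘ fun s => (F.X s, F.Y s)) * deriv F.X := funext F.surface_tangency
  rw [hfun] at hud
  have heq := hud.unique hvd
  rw [fderiv_eq_pd, fderiv_eq_pd] at heq
  simp only [Function.comp_apply, hYd, hv] at heq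
  have h2 := (graph_derivatives F.X_smooth hη hε hgr hXd hYd).2
  have he := F.euler_y_closure (F.surface_mem_closure s₀)
  rw [hv] at he
  rw [h2] at heq
  have h3 : F.u (F.X s₀, F.Y s₀) * deriv (deriv η) (F.X s₀) = pdX F.v (F.X s₀, F.Y s₀) := by
    refine mul_right_cancel₀ (pow_ne_zero 2 hXd) ?_
    linarith
  rw [sq, mul_assoc, h3]
  linarith

lemma exists_graph_of_deriv_eq_zero {s₀ : ℝ} (hYd : deriv F.Y s₀ = 0) :
    ∃ ε > 0, ∃ η : ℝ → ℝ, ContDiff ℝ 2 η ∧ η (F.X s₀) = F.Y s₀ ∧ deriv η (F.X s₀) = 0 ∧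
      ∀ s, |s - s₀| < ε → F.Y s = η (F.X s) := by
  have hXd : deriv F.X s₀ ≠ 0 := fun h => F.regular s₀ (by rw [h, hYd]; ring)
  obtain ⟨ε, hε, η, hη, hgr⟩ := exists_local_graph F.X_smooth F.Y_smooth hXd
  exact ⟨ε, hε, η, hη, (hgr s₀ (by simpa using hε)).symm,
    (graph_derivatives F.X_smooth hη hε hgr hXd hYd).1, hgr⟩

end GenPeriodicFlow

/-- **Curvature at crests and troughs.**  For a nontrivial flow with no stagnation
points in the closure of `Ω`, near any crest the free surface is locally a `C²` graph
`y = η(x)` with `η'' < 0` at the crest (strict concavity), and near any trough it is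
locally a `C²` graph with `η'' > 0` at the trough (strict convexity). -/
theorem surface_curvature_at_crest_trough (g Patm L d : ℝ) (hg : 0 < g) (hL : 0 < L)
    (hd : 0 < d)
    (F : GenPeriodicFlow g Patm L d)
    (hnt : F.Nontrivial')
    (hstag : ∀ p ∈ closure F.Ω, F.u p ^ 2 + F.v p ^ 2 ≠ 0) :
    (∀ s₀, F.Y s₀ = F.maxη →
      ∃ ε > 0, ∃ η : ℝ → ℝ, ContDiff ℝ 2 η ∧ η (F.X s₀) = F.Y s₀ ∧
        (∀ s, |s - s₀| < ε → F.Y s = η (F.X s)) ∧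
        deriv (deriv η) (F.X s₀) < 0) ∧
    (∀ s₀, F.Y s₀ = F.minη →
      ∃ ε > 0, ∃ η : ℝ → ℝ, ContDiff ℝ 2 η ∧ η (F.X s₀) = F.Y s₀ ∧
        (∀ s, |s - s₀| < ε → F.Y s = η (F.X s)) ∧
        0 < deriv (deriv η) (F.X s₀)) := by
  constructor
  · intro s₀ hs
    have hYd : deriv F.Y s₀ = 0 := IsLocalMax.deriv_eq_zero
      (Filter.Eventually.of_forall fun s => (F.le_maxη s).trans_eq hs.symm)
    obtain ⟨ε, hε, η, hη, hη0, hηd, hgr⟩ := F.exists_graph_of_deriv_eq_zero hYd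
    refine ⟨ε, hε, η, hη, hη0, hgr, ?_⟩
    have h1 := F.pdY_dynPressure_crest hg hL hnt hstag hs hε hη hgr hηd
    have h2 := F.sq_mul_curvature hε hη hgr hYd
    by_contra! h
    nlinarith [mul_nonneg (sq_nonneg (F.u (F.X s₀, F.Y s₀))) h]
  · intro s₀ hs
    have hYd : deriv F.Y s₀ = 0 := IsLocalMin.deriv_eq_zero
      (Filter.Eventually.of_forall fun s => hs.trans_le (F.minη_le s))
    obtain ⟨ε, hε, η, hη, hη0, -, hgr⟩ := F.exists_graph_of_deriv_eq_zero hYd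
    refine ⟨ε, hε, η, hη, hη0, hgr, ?_⟩
    have h1 := F.pdY_dynPressure_trough hg hL hnt hstag hs
    have h2 := F.sq_mul_curvature hε hη hgr hYd
    by_contra! h
    nlinarith [mul_nonneg (sq_nonneg (F.u (F.X s₀, F.Y s₀))) (neg_nonneg.2 h)]
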